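/- For every δ ∈ (0,1] there exists τ₀ > 0 such that for all τ, ν with 0 < ν ≤ τ ≤ τ₀ there exists n₀ ∈ ℕ such that the following holds for every even n ≥ n₀ and every positive integer r ≤ n^{1/3}: let G be a robust (ν,τ)-expander on n vertices in which every vertex has degree exactly δn, let N be a spanning r-regular subgraph of G, and for each non-negative integer j let M_j denote the set of perfect matchings of G containing exactly j edges of N. Then for every integer k with 1 ≤ k ≤ n^{1/3}, the set M_{k−1} is nonempty and (1 − n^{−1/7})·(rn/2)/(kδn) ≤ |M_k|/|M_{k−1}| ≤ (1 + n^{−1/7})·(rn/2)/(kδn). -/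

import Mathlib

open Finset

namespace RPM

/-- The `ν`-robust neighbourhood of a vertex set `S` in a graph `G` on `n` vertices:
all vertices having at least `ν * n` neighbours in `S`. -/
def RN {V : Type*} [Fintype V] (G : SimpleGraph V) (ν : ℝ) (S : Set V) : Set V :=
  {v : V | ν * (Fintype.card V : ℝ) ≤ (Nat.card {u : V | u ∈ S ∧ G.Adj v u} : ℝ)}

/-- `G` is a robust `(ν, τ)`-expander. -/
def RobustExpander {V : Type*} [Fintype V] (G : SimpleGraph V) (ν τ : ℝ) : Prop :=
  ∀ S : Set V,
    τ * (Fintype.card V : ℝ) ≤ (Nat.card S : ℝ) →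
    (Nat.card S : ℝ) ≤ (1 - τ) * (Fintype.card V : ℝ) →
    (Nat.card S : ℝ) + ν * (Fintype.card V : ℝ) ≤ (Nat.card (RN G ν S) : ℝ)

/-- `M` (a set of edges) is a perfect matching of `G`: its edges are edges of `G`,
and every vertex lies in exactly one edge of `M` (in particular the edges are
pairwise disjoint and cover all vertices). -/
def IsPM {V : Type*} (G : SimpleGraph V) (M : Finset (Sym2 V)) : Prop :=
  (∀ e ∈ M, e ∈ G.edgeSet) ∧ ∀ v : V, ∃! e, e ∈ M ∧ v ∈ e

/-- The number of perfect matchings of `G`. -/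
noncomputable def pmCount {V : Type*} (G : SimpleGraph V) : ℕ :=
  Nat.card {M : Finset (Sym2 V) // IsPM G M}

/-- `N` (a set of edges) is a matching in `G`: edges of `G`, pairwise disjoint. -/
def IsMatchingIn {V : Type*} (G : SimpleGraph V) (N : Finset (Sym2 V)) : Prop :=
  (∀ e ∈ N, e ∈ G.edgeSet) ∧ ∀ e ∈ N, ∀ f ∈ N, e ≠ f → ∀ v : V, v ∈ e → v ∉ f

/-- `G` is `d`-regular: every vertex has exactly `d` neighbours. -/
def RegularDeg {V : Type*} (G : SimpleGraph V) (d : ℕ) : Prop :=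
  ∀ v : V, Nat.card {u : V | G.Adj v u} = d

/-- Probability that a uniformly random perfect matching of `G` contains the edge `e`. -/
noncomputable def edgeProb {V : Type*} (G : SimpleGraph V) (e : Sym2 V) : ℝ :=
  (Nat.card {M : Finset (Sym2 V) // IsPM G M ∧ e ∈ M} : ℝ) / (pmCount G : ℝ)

/-- `P[X = k]` where `X = |M ∩ N|` for a uniformly random perfect matching `M` of `G`. -/
noncomputable def interProb {V : Type*} [DecidableEq V] (G : SimpleGraph V)
    (N : Finset (Sym2 V)) (k : ℕ) : ℝ :=
  (Nat.card {M : Finset (Sym2 V) // IsPM G M ∧ (M ∩ N).card = k} : ℝ) / (pmCount G : ℝ)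

/-- The Poisson probability mass function with parameter `lam`. -/
noncomputable def poissonPMF (lam : ℝ) (k : ℕ) : ℝ :=
  Real.exp (-lam) * lam ^ k / (Nat.factorial k)

/-- The number of perfect matchings of `G` containing exactly `j` edges of `N`. -/
noncomputable def pmCountInter {V : Type*} [DecidableEq V] (G : SimpleGraph V)
    (N : Finset (Sym2 V)) (j : ℕ) : ℕ :=
  Nat.card {M : Finset (Sym2 V) // IsPM G M ∧ (M ∩ N).card = j}

/-- `N` (a set of edges) is a spanning `r`-regular subgraph of `G`: all edges of `N`
are edges of `G` and every vertex lies in exactly `r` edges of `N`. -/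
def SpanningRegular {V : Type*} (G : SimpleGraph V) (N : Finset (Sym2 V)) (r : ℕ) : Prop :=
  (∀ e ∈ N, e ∈ G.edgeSet) ∧ ∀ v : V, Nat.card {e : Sym2 V // e ∈ N ∧ v ∈ e} = r

section Walks

variable {V : Type*} [Fintype V] [DecidableEq V]

open scoped Classical in
/-- The out-neighbourhood of `x` in the digraph whose arcs are an edge `x σ(x)` followed by an
edge of `G`. -/
noncomputable def altNbr (G : SimpleGraph V) (σ : Equiv.Perm V) (x : V) : Finset V :=
  univ.filter fun z => G.Adj (σ x) z

/-- The number of walks with `t` steps from `x` to `y` in the digraph given by `altNbr`. -/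
noncomputable def walkCount (G : SimpleGraph V) (σ : Equiv.Perm V) : ℕ → V → V → ℝ
  | 0, x, y => if x = y then 1 else 0
  | t + 1, x, y => ∑ z ∈ altNbr G σ x, walkCount G σ t z y

variable {G : SimpleGraph V} {σ : Equiv.Perm V} {d : ℕ}

omit [DecidableEq V] in
lemma mem_altNbr {x z : V} : z ∈ altNbr G σ x ↔ G.Adj (σ x) z := by
  simp [altNbr]

omit [DecidableEq V] in
lemma natCard_setOf_eq_card_filter (p : V → Prop) [DecidablePred p] :
    Nat.card {u : V | p u} = (univ.filter p).card := by
  rw [Nat.card_eq_card_toFinset]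
  congr 1
  ext; simp

omit [DecidableEq V] in
lemma card_altNbr (hd : RegularDeg G d) (x : V) : (altNbr G σ x).card = d := by
  classical
  rw [← hd (σ x), natCard_setOf_eq_card_filter]
  congr 1

lemma card_filter_mem_altNbr (hd : RegularDeg G d) (z : V) :
    (univ.filter fun x => z ∈ altNbr G σ x).card = d := by
  classical
  rw [← hd z, natCard_setOf_eq_card_filter]
  refine card_bij (fun x _ => σ x) ?_ (fun _ _ _ _ h => σ.injective h) ?_
  · intro a ha
    simpa [mem_altNbr, G.adj_comm] using ha
  · intro b hb
    exact ⟨σ.symm b, by simpa [mem_altNbr, G.adj_comm] using hb, by simp⟩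

lemma walkCount_nonneg (t : ℕ) (x y : V) : 0 ≤ walkCount G σ t x y := by
  induction t generalizing x with
  | zero => simp only [walkCount]; split_ifs <;> norm_num
  | succ t ih => exact sum_nonneg fun z _ => ih z

lemma sum_walkCount_right (hd : RegularDeg G d) (t : ℕ) (x : V) :
    ∑ y, walkCount G σ t x y = (d : ℝ) ^ t := by
  induction t generalizing x with
  | zero => simp [walkCount]
  | succ t ih =>
    simp only [walkCount]
    rw [sum_comm]
    simp [ih, card_altNbr hd, pow_succ, mul_comm]

lemma sum_walkCount_left (hd : RegularDeg G d) (t : ℕ) (y : V) :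
    ∑ x, walkCount G σ t x y = (d : ℝ) ^ t := by
  induction t with
  | zero => simp [walkCount]
  | succ t ih =>
    have h : ∀ x, walkCount G σ (t + 1) x y
        = ∑ z, if z ∈ altNbr G σ x then walkCount G σ t z y else 0 := by
      intro x
      simp [walkCount]
    simp_rw [h]
    rw [sum_comm]
    simp_rw [← sum_filter, sum_const, card_filter_mem_altNbr hd, nsmul_eq_mul, ← mul_sum, ih,
      pow_succ, mul_comm]

lemma walkCount_one_le (x y : V) : walkCount G σ 1 x y ≤ 1 := by
  simp only [walkCount, sum_ite_eq']
  split_ifs <;> norm_num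

lemma walkCount_succ_le (hd : RegularDeg G d) (t : ℕ) (x y : V) :
    walkCount G σ (t + 1) x y ≤ (d : ℝ) ^ t := by
  induction t generalizing x with
  | zero => simpa using walkCount_one_le x y
  | succ t ih =>
    calc walkCount G σ (t + 1 + 1) x y = ∑ z ∈ altNbr G σ x, walkCount G σ (t + 1) z y := rfl
      _ ≤ ∑ z ∈ altNbr G σ x, (d : ℝ) ^ t := sum_le_sum fun z _ => ih z
      _ = (d : ℝ) ^ (t + 1) := by simp [card_altNbr hd, pow_succ, mul_comm]

lemma walkCount_add (s t : ℕ) (x y : V) :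
    walkCount G σ (s + t) x y = ∑ z, walkCount G σ s x z * walkCount G σ t z y := by
  induction s generalizing x with
  | zero => simp [walkCount]
  | succ s ih =>
    rw [Nat.add_right_comm]
    simp only [walkCount, ih, sum_mul]
    rw [sum_comm]

lemma exists_walkCount_mem_Icc (hd : RegularDeg G d) {s : ℕ} {β : ℝ}
    (hβ : ∀ x y, β ≤ walkCount G σ s x y) (q : ℕ) (y : V) :
    ∃ lo : ℝ, ∀ x, walkCount G σ (s * q + 1) x y ∈
      Set.Icc lo (lo + ((d : ℝ) ^ s - β * Fintype.card V) ^ q) := by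
  induction q with
  | zero => exact ⟨0, fun x => ⟨walkCount_nonneg _ _ _, by simpa using walkCount_one_le x y⟩⟩
  | succ q ih =>
    obtain ⟨lo, hlo⟩ := ih
    set o := ((d : ℝ) ^ s - β * Fintype.card V) ^ q with ho
    set f := fun z => walkCount G σ (s * q + 1) z y with hf
    have hsum : ∀ x, ∑ z, (walkCount G σ s x z - β) = (d : ℝ) ^ s - β * Fintype.card V := by
      intro x
      rw [sum_sub_distrib, sum_walkCount_right hd]
      simp [mul_comm]
    have hsplit : ∀ x, walkCount G σ (s * (q + 1) + 1) x y
        = ∑ z, (walkCount G σ s x z - β) * f z + β * ∑ z, f z := by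
      intro x
      rw [show s * (q + 1) + 1 = s + (s * q + 1) by ring, walkCount_add, mul_sum,
        ← sum_add_distrib]
      exact sum_congr rfl fun z _ => by ring
    refine ⟨((d : ℝ) ^ s - β * Fintype.card V) * lo + β * ∑ z, f z, fun x => ?_⟩
    rw [hsplit x, pow_succ, ← ho]
    constructor
    · rw [← hsum x, sum_mul]
      gcongr with z
      · linarith [hβ x z]
      · exact (hlo z).1
    · have h : ∑ z, (walkCount G σ s x z - β) * f z
          ≤ ∑ z, (walkCount G σ s x z - β) * (lo + o) := by
        gcongr with z
        · linarith [hβ x z]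
        · exact (hlo z).2
      rw [← sum_mul, hsum x] at h
      linarith

lemma abs_walkCount_sub_le [Nonempty V] (hd : RegularDeg G d) {s : ℕ} {β : ℝ}
    (hβ : ∀ x y, β ≤ walkCount G σ s x y) (q : ℕ) (x y : V) :
    |walkCount G σ (s * q + 1) x y - (d : ℝ) ^ (s * q + 1) / Fintype.card V|
      ≤ ((d : ℝ) ^ s - β * Fintype.card V) ^ q := by
  obtain ⟨lo, hlo⟩ := exists_walkCount_mem_Icc hd hβ q y
  have hn : (0 : ℝ) < Fintype.card V := by exact_mod_cast Fintype.card_pos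
  have h1 : lo * Fintype.card V ≤ (d : ℝ) ^ (s * q + 1) := by
    rw [← sum_walkCount_left hd (σ := σ) _ y]
    calc lo * Fintype.card V = ∑ _z : V, lo := by simp [mul_comm]
      _ ≤ _ := sum_le_sum fun z _ => (hlo z).1
  have h2 : (d : ℝ) ^ (s * q + 1)
      ≤ (lo + ((d : ℝ) ^ s - β * Fintype.card V) ^ q) * Fintype.card V := by
    rw [← sum_walkCount_left hd (σ := σ) _ y]
    calc _ ≤ ∑ _z : V, (lo + ((d : ℝ) ^ s - β * Fintype.card V) ^ q) :=
          sum_le_sum fun z _ => (hlo z).2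
      _ = _ := by simp [mul_add, mul_comm]
  rw [← le_div_iff₀ hn] at h1
  rw [← div_le_iff₀ hn] at h2
  have := hlo x
  rw [Set.mem_Icc] at this
  rw [abs_le]
  constructor <;> linarith

/-- The vertices from which there are at least `b ^ i` walks with `i + 1` steps to `y`. -/
def richSet (G : SimpleGraph V) (σ : Equiv.Perm V) (b : ℝ) (y : V) (i : ℕ) :
    Set V :=
  {x | b ^ i ≤ walkCount G σ (i + 1) x y}

lemma natCard_RN_richSet_le {ν : ℝ} (hν : 0 ≤ ν) (y : V) (i : ℕ) :
    Nat.card (RN G ν (richSet G σ (ν * Fintype.card V) y i))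
      ≤ Nat.card (richSet G σ (ν * Fintype.card V) y (i + 1)) := by
  classical
  set b := ν * (Fintype.card V : ℝ) with hb
  have hb0 : 0 ≤ b := by positivity
  refine Nat.card_le_card_of_injective (fun u => ⟨σ.symm u.1, ?_⟩) ?_
  · have hu := u.2
    simp only [RN, Set.mem_ofPred_eq] at hu
    rw [natCard_setOf_eq_card_filter] at hu
    simp only [richSet, Set.mem_ofPred_eq]
    set F := univ.filter fun z => z ∈ richSet G σ b y i ∧ G.Adj u.1 z with hF
    have hsub : F ⊆ altNbr G σ (σ.symm u.1) := by
      intro z hz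
      simp only [hF, mem_filter] at hz
      simpa [mem_altNbr] using hz.2.2
    calc b ^ (i + 1) = b * b ^ i := pow_succ' b i
      _ ≤ F.card * b ^ i := by gcongr
      _ = ∑ z ∈ F, b ^ i := by simp
      _ ≤ ∑ z ∈ F, walkCount G σ (i + 1) z y := by
          refine sum_le_sum fun z hz => ?_
          simp only [hF, mem_filter] at hz
          exact hz.2.1
      _ ≤ _ := sum_le_sum_of_subset_of_nonneg hsub fun _ _ _ => walkCount_nonneg _ _ _
  · intro a b hab
    simpa [Subtype.ext_iff] using hab

lemma le_natCard_richSet {ν τ δ : ℝ} (hν : 0 < ν) (hτδ : 2 * τ ≤ δ) (hντ : ν ≤ τ)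
    (hd : RegularDeg G d) (hδ : (d : ℝ) = δ * Fintype.card V)
    (hG : RobustExpander G ν τ) (y : V) (i : ℕ) :
    min (Fintype.card V : ℝ) (δ * Fintype.card V + i * (ν * Fintype.card V))
      ≤ Nat.card (richSet G σ (ν * Fintype.card V) y i) := by
  classical
  set n : ℝ := (Fintype.card V : ℝ) with hn
  have hn0 : 0 ≤ n := by positivity
  induction i with
  | zero =>
    refine (min_le_right _ _).trans ?_
    rw [Nat.cast_zero, zero_mul, add_zero, ← hδ, ← card_filter_mem_altNbr (σ := σ) hd y,
      ← natCard_setOf_eq_card_filter]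
    refine Nat.cast_le.2 (Nat.card_mono (Set.toFinite _) ?_)
    intro x hx
    simp only [Set.mem_ofPred_eq] at hx
    simp [richSet, walkCount, hx]
  | succ i ih =>
    refine le_trans ?_ (Nat.cast_le.2 (natCard_RN_richSet_le hν.le y i))
    set S := richSet G σ (ν * n) y i with hS
    by_cases hbig : (Nat.card S : ℝ) ≤ (1 - τ) * n
    · have h1 := hG S ?_ hbig
      · refine le_trans ?_ h1
        push_cast
        rcases min_cases n (δ * n + i * (ν * n)) with h | h
        · exact (min_le_left _ _).trans (by rw [h.1] at ih; nlinarith)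
        · exact (min_le_right _ _).trans (by rw [h.1] at ih; linarith)
      · refine le_trans ?_ ih
        have : τ * n ≤ δ * n := by nlinarith
        refine le_min ?_ ?_
        · have h0 : (0 : ℝ) ≤ Nat.card S := by positivity
          nlinarith
        · have : 0 ≤ i * (ν * n) := by positivity
          linarith
    · have hun : RN G ν S = Set.univ := by
        refine Set.eq_univ_of_forall fun v => ?_
        simp only [RN, Set.mem_ofPred_eq]
        rw [natCard_setOf_eq_card_filter]
        have hS' : (Nat.card S : ℝ) = (univ.filter (· ∈ S)).card := by
          rw [← natCard_setOf_eq_card_filter]; rfl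
        have hv := hd v
        rw [natCard_setOf_eq_card_filter] at hv
        have h3 : (univ.filter (G.Adj v)).card ≤
            (univ.filter fun u => u ∈ S ∧ G.Adj v u).card + (univ.filter (· ∉ S)).card := by
          rw [← card_union_of_disjoint]
          · refine card_le_card fun u hu => ?_
            simp only [mem_union, mem_filter, mem_univ, true_and] at hu ⊢
            tauto
          · refine disjoint_filter.2 fun u _ h => by simp [h.1]
        have h4 := card_filter_add_card_filter_not (s := (univ : Finset V)) (· ∈ S)
        rw [card_univ] at h4
        have h3' : (d : ℝ) ≤ (univ.filter fun u => u ∈ S ∧ G.Adj v u).card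
            + (univ.filter (· ∉ S)).card := by rw [hv] at h3; exact_mod_cast h3
        have h4' : ((univ.filter (· ∈ S)).card : ℝ) + (univ.filter (· ∉ S)).card = n := by
          rw [hn]; exact_mod_cast h4
        push Not at hbig
        nlinarith
      rw [hun]
      refine (min_le_left _ _).trans ?_
      simp [hn]

lemma pow_le_walkCount {ν τ δ : ℝ} (hν : 0 < ν) (hτδ : 2 * τ ≤ δ) (hντ : ν ≤ τ)
    (hd : RegularDeg G d) (hδ : (d : ℝ) = δ * Fintype.card V)
    (hG : RobustExpander G ν τ) {i : ℕ} (hi : 1 ≤ i * ν) (x y : V) :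
    (ν * Fintype.card V) ^ i ≤ walkCount G σ (i + 1) x y := by
  classical
  have h := le_natCard_richSet (σ := σ) hν hτδ hντ hd hδ hG y i
  have hn0 : (0 : ℝ) ≤ Fintype.card V := by positivity
  rw [min_eq_left (by nlinarith [mul_nonneg (hν.le.trans (hντ.trans (by linarith : τ ≤ δ))) hn0])]
    at h
  have hun : richSet G σ (ν * Fintype.card V) y i = Set.univ := by
    refine Set.eq_of_subset_of_ncard_le (Set.subset_univ _) ?_ (Set.toFinite _)
    rw [Set.ncard_univ, Nat.card_eq_fintype_card, ← Nat.card_coe_set_eq]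
    exact_mod_cast h
  exact (hun ▸ Set.mem_univ x : x ∈ richSet G σ (ν * Fintype.card V) y i)

/-- The walks counted by `walkCount`, as tuples of vertices. -/
noncomputable def altWalks (G : SimpleGraph V) (σ : Equiv.Perm V) (t : ℕ) (x y : V) :
    Finset (Fin (t + 1) → V) :=
  univ.filter fun w => w 0 = x ∧ w (Fin.last t) = y ∧
    ∀ i : Fin t, w i.succ ∈ altNbr G σ (w i.castSucc)

lemma card_altWalks_le (t : ℕ) (x y : V) :
    ((altWalks G σ t x y).card : ℝ) ≤ walkCount G σ t x y := by
  induction t generalizing x with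
  | zero =>
    simp only [walkCount]
    split_ifs with h
    · refine Nat.cast_le_one.2 (card_le_one.2 fun a ha b hb => funext fun i => ?_)
      simp only [altWalks, mem_filter] at ha hb
      obtain rfl : i = 0 := Fin.eq_zero i
      rw [ha.2.1, hb.2.1]
    · rw [Nat.cast_nonpos, card_eq_zero, eq_empty_iff_forall_notMem]
      intro w hw
      simp only [altWalks, mem_filter] at hw
      exact h (hw.2.1.symm.trans hw.2.2.1)
  | succ t ih =>
    have hsub : altWalks G σ (t + 1) x y ⊆
        (altNbr G σ x).biUnion fun z => (altWalks G σ t z y).image (Fin.cons x) := by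
      intro w hw
      simp only [altWalks, mem_filter, mem_univ, true_and] at hw
      obtain ⟨h0, hl, hs⟩ := hw
      simp only [mem_biUnion, mem_image]
      refine ⟨w 1, ?_, Fin.tail w, ?_, ?_⟩
      · simpa [h0] using hs 0
      · simp only [altWalks, mem_filter, mem_univ, true_and, Fin.tail]
        refine ⟨rfl, hl, fun i => ?_⟩
        simpa using hs i.succ
      · rw [← h0, Fin.cons_self_tail]
    calc ((altWalks G σ (t + 1) x y).card : ℝ)
        ≤ ∑ z ∈ altNbr G σ x, ((altWalks G σ t z y).card : ℝ) := by
          exact_mod_cast (card_le_card hsub).trans (card_biUnion_le.trans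
            (sum_le_sum fun z _ => card_image_le))
      _ ≤ walkCount G σ (t + 1) x y := sum_le_sum fun z _ => ih z

/-- The walks with `m` interior vertices from `x` to `y` whose interior vertices lie outside
`Z ∪ H` and in pairwise distinct `σ`-orbits, and which take no step in `B` before the last one. -/
noncomputable def avoidWalks (G : SimpleGraph V) (σ : Equiv.Perm V) (B : V → Finset V)
    (Z : Finset V) (m : ℕ) (H : Finset V) (x y : V) : Finset (Fin (m + 2) → V) :=
  (altWalks G σ (m + 1) x y).filter fun w =>
    (∀ i : Fin m, w i.castSucc.succ ∉ Z ∪ H ∧ w i.castSucc.succ ∉ B (w i.castSucc.castSucc)) ∧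
    ∀ i j : Fin m, i < j →
      w j.castSucc.succ ≠ w i.castSucc.succ ∧ w j.castSucc.succ ≠ σ (w i.castSucc.succ)

lemma cons_mem_avoidWalks {B : V → Finset V} {Z H : Finset V} {m : ℕ} {x y z : V}
    {w : Fin (m + 2) → V} (hz : z ∈ altNbr G σ x) (hzZ : z ∉ Z ∪ H) (hzB : z ∉ B x)
    (hw : w ∈ avoidWalks G σ B Z m (H ∪ {z, σ z}) z y) :
    (Fin.cons x w : Fin (m + 3) → V) ∈ avoidWalks G σ B Z (m + 1) H x y := by
  simp only [avoidWalks, altWalks, mem_filter, mem_univ, true_and] at hw ⊢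
  obtain ⟨⟨h0, hl, hs⟩, hB, hd⟩ := hw
  refine ⟨⟨rfl, hl, ?_⟩, ?_, ?_⟩
  · refine Fin.cases ?_ fun i => ?_
    · simpa [h0] using hz
    · simpa using hs i
  · refine Fin.cases ?_ fun i => ?_
    · simpa [h0] using ⟨by simpa using hzZ, hzB⟩
    · have := hB i
      simp only [mem_union, not_or] at this
      simpa [← Fin.succ_castSucc] using ⟨⟨this.1.1, this.1.2.1⟩, this.2⟩
  · refine Fin.cases ?_ fun i => ?_ <;> refine Fin.cases ?_ fun j => ?_
    · simp
    · intro _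
      have := (hB j).1
      simp only [mem_union, mem_insert, mem_singleton, not_or] at this
      simpa [← Fin.succ_castSucc, h0] using this.2.2
    · simp
    · intro hij
      simpa [← Fin.succ_castSucc] using hd i j (by simpa using hij)

lemma le_card_avoidWalks (hd : RegularDeg G d) {B : V → Finset V} {r b : ℕ}
    (hB : ∀ x, (B x).card ≤ r) {Z : Finset V} (m : ℕ) {H : Finset V}
    (hb : Z.card + H.card + r + 2 * m ≤ b) (x y : V) :
    d * walkCount G σ (m + 1) x y - m * b * (d : ℝ) ^ m
      ≤ d * ((avoidWalks G σ B Z m H x y).card : ℝ) := by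
  induction m generalizing x H with
  | zero =>
    simp only [CharP.cast_eq_zero, zero_mul, sub_zero, walkCount, sum_ite_eq']
    gcongr
    split_ifs with h
    · rw [Nat.one_le_cast, Nat.one_le_iff_ne_zero, card_ne_zero]
      refine ⟨![x, y], ?_⟩
      simp [avoidWalks, altWalks, h]
    · positivity
  | succ m ih =>
    set S := altNbr G σ x with hS
    set T := Z ∪ H ∪ B x with hT
    have hTcard : T.card ≤ b := by
      have h1 := card_union_le (Z ∪ H) (B x)
      have h2 := card_union_le Z H
      have h3 := hB x
      rw [← hT] at h1
      omega
    have hcard : ∑ z ∈ S \ T, (avoidWalks G σ B Z m (H ∪ {z, σ z}) z y).card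
        ≤ (avoidWalks G σ B Z (m + 1) H x y).card := by
      have hinj : Function.Injective fun u : Fin (m + 2) → V => (Fin.cons x u : Fin (m + 3) → V) :=
        fun u u' h => funext fun i => by simpa using congrFun h i.succ
      calc _ = ((S \ T).biUnion fun z =>
            (avoidWalks G σ B Z m (H ∪ {z, σ z}) z y).image
              fun u : Fin (m + 2) → V => (Fin.cons x u : Fin (m + 3) → V)).card := by
            rw [card_biUnion]
            · exact sum_congr rfl fun z _ => (card_image_of_injective _ hinj).symm
            · intro z _ z' _ hne
              refine disjoint_left.2 fun w hw hw' => hne ?_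
              obtain ⟨u, hu, rfl⟩ := mem_image.1 hw
              obtain ⟨u', hu', h⟩ := mem_image.1 hw'
              obtain rfl := hinj h
              simp only [avoidWalks, altWalks, mem_filter, mem_univ, true_and] at hu hu'
              exact hu.1.1.symm.trans hu'.1.1
        _ ≤ _ := by
            refine card_le_card fun w hw => ?_
            simp only [mem_biUnion, mem_image, mem_sdiff] at hw
            obtain ⟨z, ⟨hzS, hzT⟩, u, hu, rfl⟩ := hw
            simp only [hT, mem_union, not_or] at hzT
            exact cons_mem_avoidWalks hzS (by simpa using hzT.1) hzT.2 hu
    have hstep : ∀ z, d * walkCount G σ (m + 1) z y - m * b * (d : ℝ) ^ m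
        ≤ d * ((avoidWalks G σ B Z m (H ∪ {z, σ z}) z y).card : ℝ) := by
      intro z
      refine ih ?_ z
      have h1 := card_union_le H {z, σ z}
      have h2 : ({z, σ z} : Finset V).card ≤ 2 := card_le_two
      omega
    have hsplit : walkCount G σ (m + 1 + 1) x y
        ≤ ∑ z ∈ S \ T, walkCount G σ (m + 1) z y + b * (d : ℝ) ^ m := by
      have h1 : walkCount G σ (m + 1 + 1) x y = ∑ z ∈ S, walkCount G σ (m + 1) z y := rfl
      rw [h1, ← sum_inter_add_sum_sdiff S T, add_comm]
      gcongr
      calc ∑ z ∈ S ∩ T, walkCount G σ (m + 1) z y ≤ ∑ z ∈ S ∩ T, (d : ℝ) ^ m :=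
            sum_le_sum fun z _ => walkCount_succ_le hd m z y
        _ = ((S ∩ T).card : ℝ) * (d : ℝ) ^ m := by simp
        _ ≤ b * (d : ℝ) ^ m := by
          gcongr
          exact (card_le_card inter_subset_right).trans hTcard
    have hsd : ((S \ T).card : ℝ) ≤ d := by
      rw [← card_altNbr (σ := σ) hd x]
      exact_mod_cast card_le_card sdiff_subset
    have hd0 : (0 : ℝ) ≤ d := by positivity
    calc (d : ℝ) * walkCount G σ (m + 1 + 1) x y - ((m + 1 : ℕ) : ℝ) * b * (d : ℝ) ^ (m + 1)
        ≤ d * (∑ z ∈ S \ T, walkCount G σ (m + 1) z y + b * (d : ℝ) ^ m)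
          - ((m + 1 : ℕ) : ℝ) * b * (d : ℝ) ^ (m + 1) := by gcongr
      _ = ∑ z ∈ S \ T, d * walkCount G σ (m + 1) z y - d * (m * b * (d : ℝ) ^ m) := by
          rw [mul_add, mul_sum]; push_cast; ring
      _ ≤ ∑ z ∈ S \ T, d * walkCount G σ (m + 1) z y
          - (S \ T).card * (m * b * (d : ℝ) ^ m) := by gcongr
      _ = ∑ z ∈ S \ T, (d * walkCount G σ (m + 1) z y - m * b * (d : ℝ) ^ m) := by
          rw [sum_sub_distrib]; simp
      _ ≤ ∑ z ∈ S \ T, d * ((avoidWalks G σ B Z m (H ∪ {z, σ z}) z y).card : ℝ) :=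
          sum_le_sum fun z _ => hstep z
      _ = d * ((∑ z ∈ S \ T, (avoidWalks G σ B Z m (H ∪ {z, σ z}) z y).card : ℕ) : ℝ) := by
          push_cast; rw [mul_sum]
      _ ≤ _ := by gcongr

end Walks

section Switching

variable {V : Type*} [DecidableEq V] {ι : Type*} [Fintype ι]

/-- Conjugate `σ` by the permutation which maps `a i` to `a (ρ i)`. -/
def switchPerm (ρ : Equiv.Perm ι) (a : ι ↪ V) (σ : Equiv.Perm V) : Equiv.Perm V :=
  ρ.viaFintypeEmbedding a * σ * (ρ.viaFintypeEmbedding a)⁻¹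

variable {ρ : Equiv.Perm ι} {a : ι ↪ V} {σ : Equiv.Perm V}

lemma viaFintypeEmbedding_apply_of_ne (ρ : Equiv.Perm ι) (a : ι ↪ V) {z : V}
    (hz : ∀ i, z ≠ a i) : ρ.viaFintypeEmbedding a z = z :=
  Equiv.Perm.viaFintypeEmbedding_apply_notMem_range ρ a fun ⟨i, hi⟩ => hz i hi.symm

lemma switchPerm_apply (z : V) :
    switchPerm ρ a σ (ρ.viaFintypeEmbedding a z) = ρ.viaFintypeEmbedding a (σ z) := by
  simp [switchPerm]

lemma switchPerm_involutive (hσ : Function.Involutive σ) :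
    Function.Involutive (switchPerm ρ a σ) := by
  intro z
  obtain ⟨u, rfl⟩ := (ρ.viaFintypeEmbedding a).surjective z
  rw [switchPerm_apply, switchPerm_apply, hσ u]

lemma switchPerm_ne (hσ : ∀ v, σ v ≠ v) (z : V) : switchPerm ρ a σ z ≠ z := by
  obtain ⟨u, rfl⟩ := (ρ.viaFintypeEmbedding a).surjective z
  rw [switchPerm_apply]
  exact fun h => hσ u (Equiv.injective _ h)

lemma switchPerm_apply_embedding (ha : ∀ i j, σ (a i) ≠ a j) (i : ι) :
    switchPerm ρ a σ (a (ρ i)) = σ (a i) := by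
  have h := switchPerm_apply (ρ := ρ) (a := a) (σ := σ) (a i)
  rwa [Equiv.Perm.viaFintypeEmbedding_apply_image,
    viaFintypeEmbedding_apply_of_ne ρ a (ha i)] at h

lemma switchPerm_apply_image (hσ : Function.Involutive σ) (ha : ∀ i j, σ (a i) ≠ a j) (i : ι) :
    switchPerm ρ a σ (σ (a i)) = a (ρ i) := by
  rw [← switchPerm_apply_embedding (ρ := ρ) ha i, switchPerm_involutive hσ]

lemma sum_switchPerm [Fintype V] (hσ : Function.Involutive σ) (ha : ∀ i j, σ (a i) ≠ a j)
    (g : V → V → ℤ) (hg : ∀ u v, g u v = g v u) :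
    ∑ z, g z (switchPerm ρ a σ z) =
      ∑ z, g z (σ z) + 2 * ∑ i, (g (σ (a i)) (a (ρ i)) - g (a i) (σ (a i))) := by
  set c := ρ.viaFintypeEmbedding a with hc
  have hca : ∀ i, c (a i) = a (ρ i) := Equiv.Perm.viaFintypeEmbedding_apply_image ρ a
  have hcσ : ∀ i, c (σ (a i)) = σ (a i) := fun i => viaFintypeEmbedding_apply_of_ne ρ a (ha i)
  rw [← Equiv.sum_comp c]
  have h1 : ∑ z, g (c z) (switchPerm ρ a σ (c z)) - ∑ z, g z (σ z)
      = 2 * ∑ i, (g (σ (a i)) (a (ρ i)) - g (a i) (σ (a i))) := by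
    simp only [hc, switchPerm_apply]
    rw [← hc, ← sum_sub_distrib]
    have hdisj : Disjoint (univ.map a) (univ.map (a.trans σ.toEmbedding)) := by
      refine disjoint_left.2 fun z hz hz' => ?_
      simp only [mem_map, mem_univ, true_and] at hz hz'
      obtain ⟨i, rfl⟩ := hz
      obtain ⟨j, hj⟩ := hz'
      exact ha j i hj
    rw [← sum_subset (subset_univ (univ.map a ∪ univ.map (a.trans σ.toEmbedding))),
      sum_union hdisj, sum_map, sum_map, two_mul]
    · congr 1
      · refine sum_congr rfl fun i _ => ?_
        rw [hca, hcσ, hg]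
      · refine sum_congr rfl fun i _ => ?_
        simp only [Function.Embedding.trans_apply, Equiv.coe_toEmbedding]
        rw [hcσ, hσ, hca, hg (σ (a i)) (a i)]
    · intro z _ hz
      simp only [mem_union, mem_map, mem_univ, true_and, not_or, not_exists,
        Function.Embedding.trans_apply, Equiv.coe_toEmbedding] at hz
      have hz1 : c z = z := viaFintypeEmbedding_apply_of_ne ρ a fun i h => hz.1 i h.symm
      have hz2 : c (σ z) = σ z := viaFintypeEmbedding_apply_of_ne ρ a fun i h =>
        hz.2 i (by rw [← h, hσ])
      rw [hz1, hz2, sub_self]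
  linarith

lemma switchPerm_property (hσ : Function.Involutive σ) (ha : ∀ i j, σ (a i) ≠ a j)
    {R : V → V → Prop} (hR : ∀ u v, R u v → R v u) (h1 : ∀ i, R (σ (a i)) (a (ρ i)))
    (h2 : ∀ v, (∀ i, v ≠ a i) → (∀ i, v ≠ σ (a i)) → R v (σ v)) (v : V) :
    R v (switchPerm ρ a σ v) := by
  by_cases hv : ∃ i, v = a i
  · obtain ⟨i, rfl⟩ := hv
    obtain ⟨j, rfl⟩ := ρ.surjective i
    rw [switchPerm_apply_embedding ha]
    exact hR _ _ (h1 j)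
  by_cases hv' : ∃ i, v = σ (a i)
  · obtain ⟨i, rfl⟩ := hv'
    rw [switchPerm_apply_image hσ ha]
    exact h1 i
  push Not at hv hv'
  have hz := viaFintypeEmbedding_apply_of_ne ρ a hv
  have hz' : ρ.viaFintypeEmbedding a (σ v) = σ v :=
    viaFintypeEmbedding_apply_of_ne ρ a fun i h => hv' i (by rw [← h, hσ])
  have := switchPerm_apply (ρ := ρ) (a := a) (σ := σ) v
  rw [hz, hz'] at this
  rw [this]
  exact h2 v hv hv'

lemma switchPerm_injective {σ' : Equiv.Perm V} {a' : ι ↪ V} (hσ : Function.Involutive σ)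
    (hσ' : Function.Involutive σ') (ha : ∀ i j, σ (a i) ≠ a j) (ha' : ∀ i j, σ' (a' i) ≠ a' j)
    (h1 : switchPerm ρ a σ = switchPerm ρ a' σ') (h2 : ∀ i, σ (a i) = σ' (a' i)) :
    σ = σ' ∧ a = a' := by
  have haa : a = a' := by
    ext i
    obtain ⟨j, rfl⟩ := ρ.surjective i
    rw [← switchPerm_apply_image (ρ := ρ) hσ ha j, ← switchPerm_apply_image (ρ := ρ) hσ' ha' j,
      h1, h2]
  subst haa
  refine ⟨?_, rfl⟩
  simpa [switchPerm] using h1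

end Switching

section Matchings

variable {V : Type*} [Fintype V] [DecidableEq V]

/-- The vertices `z` such that `x z ∈ N`. -/
def edgeNbr (N : Finset (Sym2 V)) (x : V) : Finset V := univ.filter fun z => s(x, z) ∈ N

/-- The vertices `v` such that `v σ(v) ∈ N`. -/
def edgeFix (N : Finset (Sym2 V)) (σ : Equiv.Perm V) : Finset V :=
  univ.filter fun z => s(z, σ z) ∈ N

/-- The vertices `z` such that `σ(z) y ∈ N`, together with `y` and `σ(y)`. -/
def endForbidden (N : Finset (Sym2 V)) (σ : Equiv.Perm V) (y : V) : Finset V :=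
  {y, σ y} ∪ univ.filter fun z => s(σ z, y) ∈ N

variable {G : SimpleGraph V} {σ : Equiv.Perm V} {N : Finset (Sym2 V)}

lemma card_filter_comp_perm (N : Finset (Sym2 V)) (σ : Equiv.Perm V) (y : V) :
    (univ.filter fun z => s(σ z, y) ∈ N).card = (edgeNbr N y).card := by
  refine card_bij (fun z _ => σ z) ?_ (fun _ _ _ _ h => σ.injective h) ?_
  · intro z hz
    simpa [edgeNbr, Sym2.eq_swap] using hz
  · intro z hz
    exact ⟨σ.symm z, by simpa [edgeNbr, Sym2.eq_swap] using hz, by simp⟩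

lemma card_endForbidden_le {r : ℕ} (hr : ∀ v, (edgeNbr N v).card ≤ r) (y : V) :
    (endForbidden N σ y).card ≤ 2 + r := by
  refine (card_union_le _ _).trans (add_le_add card_le_two ?_)
  rw [card_filter_comp_perm]
  exact hr y

lemma finRotate_castSucc {k : ℕ} (i : Fin k) : finRotate (k + 1) i.castSucc = i.succ := by
  rw [finRotate_apply, Fin.coeSucc_eq_succ]

lemma of_mem_avoidWalks (hσ : Function.Involutive σ) (hne : ∀ v, σ v ≠ v) {m : ℕ} {x y : V}
    (hxy : x ≠ y) (hxy' : x ≠ σ y) {Z : Finset V} {a : Fin (m + 3) → V}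
    (ha : a ∈ avoidWalks G σ (fun v => edgeNbr N (σ v)) (Z ∪ endForbidden N σ y) (m + 1)
      {x, σ x} x y) :
    a 0 = x ∧ a (Fin.last _) = y ∧ Function.Injective a ∧ (∀ i j, σ (a i) ≠ a j) ∧
    (∀ i, i ≠ Fin.last _ →
      G.Adj (σ (a i)) (a (finRotate _ i)) ∧ s(σ (a i), a (finRotate _ i)) ∉ N) ∧
    ∀ i, i ≠ 0 → i ≠ Fin.last _ → a i ∉ Z := by
  simp only [avoidWalks, altWalks, mem_filter, mem_univ, true_and] at ha
  obtain ⟨⟨h0, hl, hs⟩, hB, hd⟩ := ha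
  have hsep : ∀ i j, i < j → a i ≠ a j ∧ σ (a i) ≠ a j := by
    refine Fin.cases (fun j => ?_) fun i j => ?_
    · refine Fin.cases (fun h => absurd h (lt_irrefl _)) ?_ j
      refine Fin.lastCases (fun _ => ?_) fun j _ => ?_
      · rw [Fin.succ_last, h0, hl]
        exact ⟨hxy, fun h => hxy' (by rw [← h, hσ])⟩
      · have := (hB j).1
        simp only [mem_union, mem_insert, mem_singleton, not_or] at this
        rw [h0]
        exact ⟨fun h => this.2.1 h.symm, fun h => this.2.2 h.symm⟩
    · refine Fin.lastCases (fun h => ?_) (fun i => ?_) i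
      · exact absurd (Fin.le_last j) (not_le.2 (by simpa using h))
      · refine Fin.cases (fun h => absurd h (by simp)) ?_ j
        refine Fin.lastCases (fun _ => ?_) fun j h => ?_
        · have := (hB i).1
          simp only [endForbidden, mem_union, mem_insert, mem_singleton, not_or] at this
          rw [Fin.succ_last, hl]
          exact ⟨this.1.2.1.1, fun h => this.1.2.1.2 (by rw [← h, hσ])⟩
        · have := hd i j (by simpa using h)
          exact ⟨this.1.symm, this.2.symm⟩
  refine ⟨h0, hl, ?_, ?_, ?_, ?_⟩
  · intro i j hij
    rcases lt_trichotomy i j with h | h | h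
    · exact absurd hij (hsep i j h).1
    · exact h
    · exact absurd hij.symm (hsep j i h).1
  · intro i j hij
    rcases lt_trichotomy i j with h | h | h
    · exact (hsep i j h).2 hij
    · exact hne _ (h ▸ hij)
    · exact (hsep j i h).2 (by rw [← hij, hσ])
  · refine Fin.lastCases (fun h => absurd rfl h) fun i _ => ?_
    rw [finRotate_castSucc]
    refine ⟨mem_altNbr.1 (hs i), ?_⟩
    refine Fin.lastCases ?_ (fun i => ?_) i
    · have := (hB (Fin.last m)).1
      simp only [endForbidden, mem_union, mem_insert, mem_singleton, not_or, mem_filter, mem_univ,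
        true_and] at this
      rw [Fin.succ_last, hl, ← Fin.succ_last, ← Fin.succ_castSucc]
      exact this.1.2.2
    · have := (hB i).2
      simpa [edgeNbr] using this
  · refine Fin.cases (fun h => absurd rfl h) fun i _ => ?_
    refine Fin.lastCases (fun h => absurd (Fin.succ_last _) h) (fun i _ => ?_) i
    have := (hB i).1
    simp only [mem_union, not_or] at this
    exact this.1.1

/-- Fixed-point-free involutions encode the perfect matchings of `G`; these are the ones with
exactly `j` edges in `N`. -/
noncomputable def matchingPerms (G : SimpleGraph V) (N : Finset (Sym2 V)) (j : ℕ) :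
    Finset (Equiv.Perm V) := by
  classical
  exact univ.filter fun σ =>
    Function.Involutive σ ∧ (∀ v, G.Adj v (σ v)) ∧ (edgeFix N σ).card = 2 * j

lemma mem_matchingPerms {j : ℕ} : σ ∈ matchingPerms G N j ↔
    Function.Involutive σ ∧ (∀ v, G.Adj v (σ v)) ∧ (edgeFix N σ).card = 2 * j := by
  simp [matchingPerms]

lemma card_edgeFix_eq_sum (N : Finset (Sym2 V)) (σ : Equiv.Perm V) :
    ((edgeFix N σ).card : ℤ) = ∑ z, if s(z, σ z) ∈ N then 1 else 0 := by
  simp [edgeFix]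

/-- Closed walks with `m + 2` steps in the digraph given by `altNbr`. -/
noncomputable def closedWalks (G : SimpleGraph V) (σ : Equiv.Perm V) (m : ℕ) :
    Finset (Fin (m + 2) → V) := by
  classical
  exact univ.filter fun a => ∀ i, G.Adj (σ (a i)) (a (finRotate _ i))

omit [DecidableEq V] in
lemma mem_closedWalks {m : ℕ} {a : Fin (m + 2) → V} :
    a ∈ closedWalks G σ m ↔ ∀ i, G.Adj (σ (a i)) (a (finRotate _ i)) := by
  simp [closedWalks]

lemma card_closedWalks_filter_le {m : ℕ} {U : ℝ}
    (hU : ∀ x y, walkCount G σ (m + 1) x y ≤ U) (Q : Finset (V × V))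
    (p : (Fin (m + 2) → V) → Prop) [DecidablePred p]
    (hp : ∀ a ∈ closedWalks G σ m, p a → (a 0, a (Fin.last _)) ∈ Q) :
    (((closedWalks G σ m).filter p).card : ℝ) ≤ Q.card * U := by
  have hsub : (closedWalks G σ m).filter p ⊆ Q.biUnion fun q => altWalks G σ (m + 1) q.1 q.2 := by
    intro a ha
    rw [mem_filter] at ha
    rw [mem_biUnion]
    refine ⟨_, hp a ha.1 ha.2, ?_⟩
    simp only [altWalks, mem_filter, mem_univ, true_and]
    intro i
    rw [mem_altNbr, ← finRotate_castSucc]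
    exact mem_closedWalks.1 ha.1 _
  calc (((closedWalks G σ m).filter p).card : ℝ)
      ≤ ∑ q ∈ Q, ((altWalks G σ (m + 1) q.1 q.2).card : ℝ) := by
        exact_mod_cast (card_le_card hsub).trans card_biUnion_le
    _ ≤ ∑ q ∈ Q, U := sum_le_sum fun q _ => (card_altWalks_le _ _ _).trans (hU _ _)
    _ = Q.card * U := by simp

/-- The union of the sets `avoidWalks` over the pairs of endpoints in `Q`. -/
noncomputable def goodWalks (G : SimpleGraph V) (σ : Equiv.Perm V) (N : Finset (Sym2 V)) (m : ℕ)
    (Q : Finset (V × V)) : Finset (Fin (m + 3) → V) :=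
  Q.biUnion fun q => avoidWalks G σ (fun v => edgeNbr N (σ v))
    (edgeFix N σ ∪ endForbidden N σ q.2) (m + 1) {q.1, σ q.1} q.1 q.2

lemma le_card_goodWalks {m : ℕ} {L : ℝ} (Q : Finset (V × V))
    (hL : ∀ x y, L ≤ ((avoidWalks G σ (fun v => edgeNbr N (σ v))
      (edgeFix N σ ∪ endForbidden N σ y) (m + 1) {x, σ x} x y).card : ℝ)) :
    Q.card * L ≤ ((goodWalks G σ N m Q).card : ℝ) := by
  rw [goodWalks, card_biUnion]
  · push_cast
    rw [← nsmul_eq_mul, ← sum_const]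
    exact sum_le_sum fun q _ => hL _ _
  · intro q _ q' _ hne
    refine disjoint_left.2 fun w hw hw' => hne ?_
    simp only [avoidWalks, altWalks, mem_filter, mem_univ, true_and] at hw hw'
    exact Prod.ext (hw.1.1.symm.trans hw'.1.1) (hw.1.2.1.symm.trans hw'.1.2.1)

omit [Fintype V] in
lemma sum_card_le_of_switch {k : ℕ} (ρ τ : Equiv.Perm (Fin k)) (S S' : Finset (Equiv.Perm V))
    (X Y : Equiv.Perm V → Finset (Fin k → V))
    (h : ∀ σ ∈ S, ∀ a ∈ X σ, Function.Involutive σ ∧ ∃ ha : Function.Injective a,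
      (∀ i j, σ (a i) ≠ a j) ∧ switchPerm ρ ⟨a, ha⟩ σ ∈ S' ∧
        (fun i => σ (a (τ i))) ∈ Y (switchPerm ρ ⟨a, ha⟩ σ)) :
    ∑ σ ∈ S, (X σ).card ≤ ∑ σ ∈ S', (Y σ).card := by
  rw [← card_sigma, ← card_sigma]
  refine card_le_card_of_forall_subsingleton
    (fun p q => ∃ ha : Function.Injective p.2, q.1 = switchPerm ρ ⟨p.2, ha⟩ p.1 ∧
      q.2 = fun i => p.1 (p.2 (τ i))) ?_ ?_
  · rintro ⟨σ, a⟩ hp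
    rw [mem_sigma] at hp
    obtain ⟨-, ha, -, hS, hY⟩ := h σ hp.1 a hp.2
    exact ⟨⟨_, _⟩, mem_sigma.2 ⟨hS, hY⟩, ha, rfl, rfl⟩
  · rintro ⟨σ', a'⟩ - ⟨σ₁, a₁⟩ ⟨h₁, i₁, e₁, f₁⟩ ⟨σ₂, a₂⟩ ⟨h₂, i₂, e₂, f₂⟩
    rw [mem_sigma] at h₁ h₂
    obtain ⟨v₁, _, s₁, -⟩ := h σ₁ h₁.1 a₁ h₁.2
    obtain ⟨v₂, _, s₂, -⟩ := h σ₂ h₂.1 a₂ h₂.2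
    obtain ⟨hσ, haa⟩ := switchPerm_injective (a := ⟨a₁, i₁⟩) (a' := ⟨a₂, i₂⟩) v₁ v₂ s₁ s₂
      (e₁.symm.trans e₂) (fun i => by
        have := congrFun (f₁.symm.trans f₂) (τ.symm i)
        simpa using this)
    obtain rfl := hσ
    obtain rfl : a₁ = a₂ := congrArg (fun f : Fin k ↪ V => (f : Fin k → V)) haa
    rfl

/-- Endpoint pairs of closed walks starting with a vertex of `edgeFix`. -/
noncomputable def fixPairs (G : SimpleGraph V) (N : Finset (Sym2 V)) (σ : Equiv.Perm V) :
    Finset (V × V) := by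
  classical
  exact univ.filter fun q => q.1 ∈ edgeFix N σ ∧ G.Adj (σ q.2) q.1

/-- Endpoint pairs of closed walks whose last step is an edge of `N`. -/
def stepPairs (N : Finset (Sym2 V)) (σ : Equiv.Perm V) : Finset (V × V) :=
  univ.filter fun q => s(σ q.2, q.1) ∈ N

omit [DecidableEq V] in
lemma card_filter_prod (p : V × V → Prop) [DecidablePred p] :
    (univ.filter p).card = ∑ x, (univ.filter fun y => p (x, y)).card := by
  simp_rw [card_filter]
  rw [Fintype.sum_prod_type]

lemma card_fixPairs_le {d : ℕ} (hd : RegularDeg G d) :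
    (fixPairs G N σ).card ≤ (edgeFix N σ).card * d := by
  classical
  rw [fixPairs, card_filter_prod, ← sum_subset (subset_univ (edgeFix N σ)), ← smul_eq_mul]
  · refine sum_le_card_nsmul _ _ _ fun x hx => ?_
    rw [← card_filter_mem_altNbr (σ := σ) hd x]
    exact card_le_card fun y => by simp [mem_altNbr]
  · intro x _ hx
    simp [hx]

lemma card_stepPairs {r : ℕ} (hr : ∀ v, (edgeNbr N v).card = r) :
    (stepPairs N σ).card = Fintype.card V * r := by
  rw [stepPairs, card_filter_prod]
  simp [card_filter_comp_perm, hr]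

/-- The pairs in `fixPairs` which avoid `N` everywhere else. -/
noncomputable def goodFixPairs (G : SimpleGraph V) (N : Finset (Sym2 V)) (σ : Equiv.Perm V) :
    Finset (V × V) :=
  (fixPairs G N σ).filter fun q => q.2 ∉ edgeFix N σ ∧ s(σ q.2, q.1) ∉ N

/-- The pairs in `stepPairs` which avoid `N` everywhere else. -/
def goodStepPairs (N : Finset (Sym2 V)) (σ : Equiv.Perm V) : Finset (V × V) :=
  (stepPairs N σ).filter fun q => q.1 ∉ edgeFix N σ ∧ q.2 ∉ edgeFix N σ

lemma le_card_goodFixPairs {d r : ℕ} (hd : RegularDeg G d) (hr : ∀ v, (edgeNbr N v).card = r) :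
    (edgeFix N σ).card * d
      ≤ (goodFixPairs G N σ).card + (edgeFix N σ).card * ((edgeFix N σ).card + r) := by
  classical
  have h : goodFixPairs G N σ = univ.filter fun q : V × V => q.1 ∈ edgeFix N σ ∧
      G.Adj (σ q.2) q.1 ∧ q.2 ∉ edgeFix N σ ∧ s(σ q.2, q.1) ∉ N := by
    ext q
    simp [goodFixPairs, fixPairs, and_assoc]
  rw [h, card_filter_prod, ← sum_subset (subset_univ (edgeFix N σ)), ← smul_eq_mul,
    ← smul_eq_mul, ← sum_const, ← sum_const, ← sum_add_distrib]
  · refine sum_le_sum fun x hx => ?_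
    rw [← card_filter_mem_altNbr (σ := σ) hd x, ← hr x, ← card_filter_comp_perm N σ x]
    refine le_trans (card_le_card (t := (univ.filter fun y => x ∈ edgeFix N σ ∧
      G.Adj (σ y) x ∧ y ∉ edgeFix N σ ∧ s(σ y, x) ∉ N) ∪ (edgeFix N σ ∪
        univ.filter fun y => s(σ y, x) ∈ N)) ?_)
      ((card_union_le _ _).trans (add_le_add_right (card_union_le _ _) _))
    intro y hy
    simp only [mem_filter, mem_univ, true_and, mem_altNbr, mem_union] at hy ⊢
    tauto
  · intro x _ hx
    simp [hx]

lemma le_card_goodStepPairs {r : ℕ} (hr : ∀ v, (edgeNbr N v).card = r) :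
    Fintype.card V * r ≤ (goodStepPairs N σ).card + 2 * ((edgeFix N σ).card * r) := by
  have h1 : (univ.filter fun q : V × V => q.1 ∈ edgeFix N σ ∧ s(σ q.2, q.1) ∈ N).card
      = (edgeFix N σ).card * r := by
    rw [card_filter_prod, ← sum_subset (subset_univ (edgeFix N σ)), ← smul_eq_mul, ← sum_const]
    · refine sum_congr rfl fun x hx => ?_
      simp [hx, card_filter_comp_perm, hr]
    · intro x _ hx
      simp [hx]
  have h2 : (univ.filter fun q : V × V => q.2 ∈ edgeFix N σ ∧ s(σ q.2, q.1) ∈ N).card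
      = (edgeFix N σ).card * r := by
    rw [card_filter, Fintype.sum_prod_type_right]
    simp_rw [← card_filter]
    rw [← sum_subset (subset_univ (edgeFix N σ)), ← smul_eq_mul, ← sum_const]
    · refine sum_congr rfl fun x hx => ?_
      rw [← hr (σ x)]
      simp [hx, edgeNbr]
    · intro x _ hx
      simp [hx]
  rw [← card_stepPairs (σ := σ) hr, two_mul]
  nth_rewrite 1 [← h1]
  rw [← h2]
  refine le_trans (card_le_card ?_)
    ((card_union_le _ _).trans (add_le_add_right (card_union_le _ _) _))
  intro q hq
  simp only [goodStepPairs, stepPairs, mem_filter, mem_univ, true_and, mem_union] at hq ⊢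
  tauto

lemma mem_matchingPerms_switchPerm {m j j' : ℕ}
    (hσ : σ ∈ matchingPerms G N j) {a : Fin m ↪ V} (ha : ∀ i i', σ (a i) ≠ a i')
    {ρ : Equiv.Perm (Fin m)} (hadj : ∀ i, G.Adj (σ (a i)) (a (ρ i)))
    (hcount : (j' : ℤ) = j + ∑ i, ((if s(σ (a i), a (ρ i)) ∈ N then 1 else 0)
      - if s(a i, σ (a i)) ∈ N then 1 else 0)) :
    switchPerm ρ a σ ∈ matchingPerms G N j' := by
  rw [mem_matchingPerms] at hσ ⊢
  obtain ⟨h1, h2, h3⟩ := hσ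
  refine ⟨switchPerm_involutive h1, ?_, ?_⟩
  · exact switchPerm_property h1 ha (fun _ _ h => h.symm) hadj fun v _ _ => h2 v
  · have h := sum_switchPerm (ρ := ρ) h1 ha (fun u v => if s(u, v) ∈ N then 1 else 0)
      (fun u v => by rw [Sym2.eq_swap])
    rw [← card_edgeFix_eq_sum, ← card_edgeFix_eq_sum, h3] at h
    zify
    rw [h, hcount]
    push_cast
    ring

lemma sum_goodFix_le (m j : ℕ) :
    ∑ σ ∈ matchingPerms G N (j + 1), (goodWalks G σ N m (goodFixPairs G N σ)).card ≤
      ∑ σ ∈ matchingPerms G N j, ((closedWalks G σ (m + 1)).filter fun a =>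
        s(σ (a (Fin.last _)), a 0) ∈ N).card := by
  refine sum_card_le_of_switch (finRotate _) 1 _ _ _ _ fun σ hσ a ha => ?_
  obtain ⟨h1, h2, h3⟩ := mem_matchingPerms.1 hσ
  have hne : ∀ v, σ v ≠ v := fun v => (h2 v).ne'
  simp only [goodWalks, mem_biUnion, Prod.exists] at ha
  obtain ⟨x, y, hq, ha⟩ := ha
  simp only [goodFixPairs, fixPairs, mem_filter, mem_univ, true_and] at hq
  obtain ⟨⟨hx, hyx⟩, hy, hyxN⟩ := hq
  have hxy : x ≠ y := by
    rintro rfl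
    exact hy hx
  obtain ⟨h0, hl, hinj, hsep, hstep, hint⟩ := of_mem_avoidWalks h1 hne hxy hyx.ne' ha
  have hadj : ∀ i, G.Adj (σ (a i)) (a (finRotate _ i)) := by
    intro i
    by_cases hi : i = Fin.last _
    · rw [hi, finRotate_last, h0, hl]
      exact hyx
    · exact (hstep i hi).1
  have hstepN : ∀ i, s(σ (a i), a (finRotate _ i)) ∉ N := by
    intro i
    by_cases hi : i = Fin.last _
    · rw [hi, finRotate_last, h0, hl]
      exact hyxN
    · exact (hstep i hi).2
  have hpair : ∀ i, i ≠ 0 → s(a i, σ (a i)) ∉ N := by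
    intro i hi hmem
    by_cases hi' : i = Fin.last _
    · exact hy (by simpa [edgeFix, hi', hl] using hmem)
    · exact hint i hi hi' (by simpa [edgeFix] using hmem)
  have hx' : s(a 0, σ (a 0)) ∈ N := by simpa [h0, edgeFix] using hx
  refine ⟨h1, hinj, hsep, mem_matchingPerms_switchPerm hσ hsep hadj ?_, ?_⟩
  · rw [Fintype.sum_eq_single 0]
    · simp [hx', hstepN, -finRotate_apply]
    · intro i hi
      simp [hpair i hi, hstepN, -finRotate_apply]
  · have himg := switchPerm_apply_image (ρ := finRotate (m + 3)) (a := ⟨a, hinj⟩) h1 hsep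
    simp only [Function.Embedding.coeFn_mk] at himg
    rw [mem_filter, mem_closedWalks]
    simp only [Equiv.Perm.coe_one, id_eq, himg]
    refine ⟨fun i => h2 _, ?_⟩
    rw [finRotate_last]
    exact hx'

lemma sum_goodStep_le (hN : ∀ e ∈ N, e ∈ G.edgeSet) (m j : ℕ) :
    ∑ σ ∈ matchingPerms G N j, (goodWalks G σ N m (goodStepPairs N σ)).card ≤
      ∑ σ ∈ matchingPerms G N (j + 1), ((closedWalks G σ (m + 1)).filter fun a =>
        s(a 0, σ (a 0)) ∈ N).card := by
  refine sum_card_le_of_switch (finRotate _) (finRotate _).symm _ _ _ _ fun σ hσ a ha => ?_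
  obtain ⟨h1, h2, h3⟩ := mem_matchingPerms.1 hσ
  have hne : ∀ v, σ v ≠ v := fun v => (h2 v).ne'
  simp only [goodWalks, mem_biUnion, Prod.exists] at ha
  obtain ⟨x, y, hq, ha⟩ := ha
  simp only [goodStepPairs, stepPairs, mem_filter, mem_univ, true_and] at hq
  obtain ⟨hyxN, hx, hy⟩ := hq
  have hyx : G.Adj (σ y) x := hN _ hyxN
  have hxy : x ≠ y := by
    rintro rfl
    exact hx (by simpa [edgeFix, Sym2.eq_swap] using hyxN)
  obtain ⟨h0, hl, hinj, hsep, hstep, hint⟩ := of_mem_avoidWalks h1 hne hxy hyx.ne' ha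
  have hadj : ∀ i, G.Adj (σ (a i)) (a (finRotate _ i)) := by
    intro i
    by_cases hi : i = Fin.last _
    · rw [hi, finRotate_last, h0, hl]
      exact hyx
    · exact (hstep i hi).1
  have hlast : s(σ (a (Fin.last _)), a 0) ∈ N := by rwa [h0, hl]
  have hpair : ∀ i, s(a i, σ (a i)) ∉ N := by
    intro i hmem
    by_cases hi : i = 0
    · exact hx (by simpa [edgeFix, hi, h0] using hmem)
    by_cases hi' : i = Fin.last _
    · exact hy (by simpa [edgeFix, hi', hl] using hmem)
    · exact hint i hi hi' (by simpa [edgeFix] using hmem)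
  refine ⟨h1, hinj, hsep, mem_matchingPerms_switchPerm hσ hsep hadj ?_, ?_⟩
  · rw [Fintype.sum_eq_single (Fin.last _)]
    · simp [hpair, hlast]
    · intro i hi
      simp [hpair i, (hstep i hi).2, -finRotate_apply]
  · have himg := switchPerm_apply_image (ρ := finRotate (m + 3)) (a := ⟨a, hinj⟩) h1 hsep
    simp only [Function.Embedding.coeFn_mk] at himg
    have hinv : (finRotate (m + 3)).symm 0 = Fin.last _ := by
      rw [Equiv.symm_apply_eq, finRotate_last]
    rw [mem_filter, mem_closedWalks]
    simp only [himg, Equiv.apply_symm_apply, Equiv.symm_apply_apply, hinv, finRotate_last]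
    refine ⟨fun i => h2 _, ?_⟩
    exact hlast

lemma exists_mem_matchingPerms_zero {m d r : ℕ}
    (hd : RegularDeg G d) (hr : ∀ v, (edgeNbr N v).card = r) (hrd : r + 1 < d)
    (heven : Even (Fintype.card V))
    (hpos : ∀ σ : Equiv.Perm V, ∀ x y, (avoidWalks G σ (fun v => edgeNbr N (σ v))
      (endForbidden N σ y) (m + 1) {x, σ x} x y).Nonempty) :
    (matchingPerms G N 0).Nonempty := by
  classical
  set g : V → V → ℤ := fun u v => if G.Adj u v ∧ s(u, v) ∉ N then 0 else 1 with hg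
  have hgs : ∀ u v, g u v = g v u := fun u v => by
    simp only [hg, G.adj_comm u v, Sym2.eq_swap (a := u) (b := v)]
  have hg0 : ∀ u v, 0 ≤ g u v := fun u v => by simp only [hg]; split_ifs <;> norm_num
  obtain ⟨k, hk⟩ := heven
  obtain ⟨e⟩ : Nonempty (V ≃ Fin k ⊕ Fin k) := Fintype.card_eq.1 (by simp [hk])
  set S : Finset (Equiv.Perm V) := univ.filter fun σ =>
    Function.Involutive σ ∧ ∀ v, σ v ≠ v with hS
  have hSne : S.Nonempty := by
    refine ⟨(e.trans (Equiv.sumComm _ _)).trans e.symm, ?_⟩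
    simp only [hS, mem_filter, mem_univ, true_and]
    refine ⟨fun v => by simp, fun v => ?_⟩
    simp only [Equiv.trans_apply, ne_eq, Equiv.symm_apply_eq]
    rcases e v with i | i <;> simp
  obtain ⟨σ, hσS, hmin⟩ := exists_min_image S (fun σ => ∑ z, g z (σ z)) hSne
  simp only [hS, mem_filter, mem_univ, true_and] at hσS hmin
  obtain ⟨h1, hne⟩ := hσS
  suffices h : ∀ x, G.Adj x (σ x) ∧ s(x, σ x) ∉ N by
    refine ⟨σ, mem_matchingPerms.2 ⟨h1, fun v => (h v).1, ?_⟩⟩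
    simp [edgeFix, h]
  by_contra! hx
  obtain ⟨x, hx⟩ := hx
  obtain ⟨y, hyx, hyN, hxy⟩ : ∃ y, G.Adj (σ y) x ∧ s(σ y, x) ∉ N ∧ x ≠ y := by
    by_contra! hy
    have : (univ.filter fun y => x ∈ altNbr G σ y) ⊆
        (univ.filter fun y => s(σ y, x) ∈ N) ∪ {x} := by
      intro y hyx
      simp only [mem_filter, mem_univ, true_and, mem_altNbr, mem_union, mem_singleton] at hyx ⊢
      by_contra! hcon
      exact hcon.2 (hy y hyx hcon.1).symm
    have h := (card_le_card this).trans (card_union_le _ _)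
    rw [card_filter_mem_altNbr hd, card_filter_comp_perm, hr, card_singleton] at h
    omega
  obtain ⟨a, ha⟩ := hpos σ x y
  rw [← empty_union (endForbidden N σ y)] at ha
  obtain ⟨h0, hl, hinj, hsep, hstep, -⟩ := of_mem_avoidWalks h1 hne hxy hyx.ne' ha
  have hgood : ∀ i, g (σ (a i)) (a (finRotate _ i)) = 0 := by
    intro i
    simp only [hg]
    rw [if_pos]
    by_cases hi : i = Fin.last _
    · rw [hi, finRotate_last, h0, hl]
      exact ⟨hyx, hyN⟩
    · exact hstep i hi
  have hsum := sum_switchPerm (ρ := finRotate (m + 3)) (a := ⟨a, hinj⟩) h1 hsep g hgs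
  have hle := hmin (switchPerm (finRotate (m + 3)) ⟨a, hinj⟩ σ)
    ⟨switchPerm_involutive h1, switchPerm_ne hne⟩
  simp only [Function.Embedding.coeFn_mk, hgood, zero_sub, sum_neg_distrib] at hsum
  have hbad : g (a 0) (σ (a 0)) = 1 := by
    simp only [hg, h0]
    rw [if_neg]
    rintro ⟨h, h'⟩
    exact h' (hx h)
  have hsing : g (a 0) (σ (a 0)) ≤ ∑ i, g (a i) (σ (a i)) :=
    single_le_sum (f := fun i => g (a i) (σ (a i))) (fun i _ => hg0 _ _) (mem_univ 0)
  linarith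

/-- The edges `v σ(v)`. -/
def permEdges (σ : Equiv.Perm V) : Finset (Sym2 V) := univ.image fun v => s(v, σ v)

lemma mem_permEdges (v : V) : s(v, σ v) ∈ permEdges σ := mem_image_of_mem _ (mem_univ v)

lemma eq_of_mem_permEdges (hσ : Function.Involutive σ) {e : Sym2 V} (he : e ∈ permEdges σ) {v : V}
    (hv : v ∈ e) : e = s(v, σ v) := by
  obtain ⟨w, -, rfl⟩ := mem_image.1 he
  rcases Sym2.mem_iff.1 hv with rfl | rfl
  · rfl
  · rw [hσ, Sym2.eq_swap]

lemma isPM_permEdges (hσ : Function.Involutive σ) (hG : ∀ v, G.Adj v (σ v)) :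
    IsPM G (permEdges σ) := by
  refine ⟨fun e he => ?_, fun v => ⟨s(v, σ v), ⟨mem_permEdges v, Sym2.mem_mk_left _ _⟩, ?_⟩⟩
  · obtain ⟨w, -, rfl⟩ := mem_image.1 he
    exact hG w
  · rintro e ⟨he, hv⟩
    exact eq_of_mem_permEdges hσ he hv

lemma card_edgeFix (hσ : Function.Involutive σ) (hne : ∀ v, σ v ≠ v) (N : Finset (Sym2 V)) :
    (edgeFix N σ).card = 2 * (permEdges σ ∩ N).card := by
  rw [card_eq_sum_card_fiberwise (f := fun v => s(v, σ v)) (t := permEdges σ ∩ N), mul_comm,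
    ← smul_eq_mul, ← sum_const]
  · refine sum_congr rfl fun e he => ?_
    obtain ⟨he, heN⟩ := mem_inter.1 he
    obtain ⟨w, -, rfl⟩ := mem_image.1 he
    rw [← card_pair (hne w).symm]
    congr 1
    ext v
    simp only [edgeFix, mem_filter, mem_univ, true_and, mem_insert, mem_singleton]
    refine ⟨fun h => ?_, fun h => ?_⟩
    · have := Sym2.mem_mk_left v (σ v)
      rw [h.2] at this
      exact Sym2.mem_iff.1 this
    · have := eq_of_mem_permEdges hσ he (Sym2.mem_iff.2 h)
      rw [← this]
      exact ⟨heN, rfl⟩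
  · intro v hv
    simp only [edgeFix, coe_filter, mem_univ, true_and, Set.mem_ofPred_eq] at hv
    exact mem_coe.2 (mem_inter.2 ⟨mem_permEdges v, hv⟩)

lemma exists_permEdges_eq {M : Finset (Sym2 V)} (hM : IsPM G M) :
    ∃ σ : Equiv.Perm V, Function.Involutive σ ∧ (∀ v, G.Adj v (σ v)) ∧ permEdges σ = M := by
  choose e he hu using hM.2
  simp only at he hu
  have hother : ∀ v, ∃ w, e v = s(v, w) := fun v => (Sym2.mem_iff_exists.1 (he v).2)
  choose f hf using hother
  have hinv : Function.Involutive f := by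
    intro v
    have h : e v = e (f v) := hu (f v) (e v) ⟨(he v).1, by rw [hf v]; exact Sym2.mem_mk_right _ _⟩
    rw [hf v, hf (f v), Sym2.eq_swap, Sym2.congr_right] at h
    exact h.symm
  refine ⟨hinv.toPerm f, hinv, fun v => ?_, ?_⟩
  · have h := hM.1 _ (he v).1
    rwa [hf v] at h
  · ext z
    simp only [permEdges, Function.Involutive.coe_toPerm, mem_image, mem_univ, true_and]
    refine ⟨?_, fun hz => ?_⟩
    · rintro ⟨v, rfl⟩
      rw [← hf]
      exact (he v).1
    · induction z with
      | h a b => exact ⟨a, by rw [← hf, hu a _ ⟨hz, Sym2.mem_mk_left a b⟩]⟩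

lemma pmCountInter_eq_card (G : SimpleGraph V) (N : Finset (Sym2 V)) (j : ℕ) :
    pmCountInter G N j = (matchingPerms G N j).card := by
  rw [pmCountInter, ← Fintype.card_coe, ← Nat.card_eq_fintype_card]
  symm
  refine Nat.card_eq_of_bijective (fun σ => ⟨permEdges σ.1, ?_, ?_⟩) ⟨?_, ?_⟩
  · obtain ⟨h1, h2, -⟩ := mem_matchingPerms.1 σ.2
    exact isPM_permEdges h1 h2
  · obtain ⟨h1, h2, h3⟩ := mem_matchingPerms.1 σ.2
    rw [card_edgeFix h1 fun v => (h2 v).ne'] at h3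
    omega
  · rintro ⟨σ, hσ⟩ ⟨σ', hσ'⟩ h
    rw [Subtype.mk.injEq] at h ⊢
    ext v
    have hv := mem_permEdges (σ := σ) v
    rw [h] at hv
    exact Sym2.congr_right.1
      (eq_of_mem_permEdges (mem_matchingPerms.1 hσ').1 hv (Sym2.mem_mk_left _ _))
  · rintro ⟨M, hM, hj⟩
    obtain ⟨σ, h1, h2, rfl⟩ := exists_permEdges_eq hM
    exact ⟨⟨σ, mem_matchingPerms.2 ⟨h1, h2, by rw [card_edgeFix h1 fun v => (h2 v).ne', hj]⟩⟩, rfl⟩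

lemma SpanningRegular.card_edgeNbr {r : ℕ} (hN : SpanningRegular G N r) (v : V) :
    (edgeNbr N v).card = r := by
  rw [← hN.2 v, ← Fintype.card_coe, ← Nat.card_eq_fintype_card]
  refine Nat.card_eq_of_bijective
    (fun z => ⟨s(v, z.1), by simpa [edgeNbr] using z.2, Sym2.mem_mk_left _ _⟩) ⟨?_, ?_⟩
  · rintro ⟨z, hz⟩ ⟨z', hz'⟩ h
    exact Subtype.ext (Sym2.congr_right.1 (congrArg Subtype.val h))
  · rintro ⟨e, he, hv⟩
    obtain ⟨w, rfl⟩ := Sym2.mem_iff_exists.1 hv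
    exact ⟨⟨w, by simpa [edgeNbr] using he⟩, rfl⟩

section Ratio

variable {d r m : ℕ} {η : ℝ}

lemma le_card_avoidWalks_of_walkCount (hd : RegularDeg G d) (hd0 : 0 < d)
    (hr : ∀ v, (edgeNbr N v).card = r)
    (hW : ∀ x y, |walkCount G σ (m + 2) x y - (d : ℝ) ^ (m + 2) / Fintype.card V|
      ≤ η * ((d : ℝ) ^ (m + 2) / Fintype.card V))
    {K : ℕ} (hm : (m + 1 : ℝ) * (2 * K + 2 * r + 2 * m + 6) * Fintype.card V ≤ η * d ^ 2)
    {F : Finset V} (hF : F.card ≤ 2 * K) (x y : V) :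
    (1 - 2 * η) * ((d : ℝ) ^ (m + 2) / Fintype.card V) ≤
      ((avoidWalks G σ (fun v => edgeNbr N (σ v)) (F ∪ endForbidden N σ y) (m + 1)
        {x, σ x} x y).card : ℝ) := by
  have hn : (0 : ℝ) < Fintype.card V := by exact_mod_cast Fintype.card_pos_iff.2 ⟨x⟩
  have hdR : (0 : ℝ) < d := by exact_mod_cast hd0
  have hZ : (F ∪ endForbidden N σ y).card + ({x, σ x} : Finset V).card + r + 2 * (m + 1)
      ≤ 2 * K + 2 * r + 2 * m + 6 := by
    have h1 := card_union_le F (endForbidden N σ y)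
    have h2 := card_endForbidden_le (σ := σ) (fun v => (hr v).le) y
    have h3 := card_le_two (a := x) (b := σ x)
    omega
  have h := le_card_avoidWalks (σ := σ) hd (B := fun v => edgeNbr N (σ v))
    (fun v => (hr (σ v)).le) (m + 1) hZ x y
  have hWxy := (abs_le.1 (hW x y)).1
  have hm' : ((m + 1 : ℕ) : ℝ) * ((2 * K + 2 * r + 2 * m + 6 : ℕ) : ℝ) * (d : ℝ) ^ (m + 1)
      ≤ d * (η * ((d : ℝ) ^ (m + 2) / Fintype.card V)) := by
    rw [← mul_div_assoc, ← mul_div_assoc, le_div_iff₀ hn]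
    push_cast
    calc _ = ((m + 1 : ℝ) * (2 * K + 2 * r + 2 * m + 6) * Fintype.card V) * (d : ℝ) ^ (m + 1) := by
          ring
      _ ≤ η * d ^ 2 * (d : ℝ) ^ (m + 1) := by gcongr
      _ = _ := by ring
  refine le_of_mul_le_mul_left ?_ hdR
  have := mul_le_mul_of_nonneg_left hWxy hdR.le
  linarith

variable [Nonempty V]

lemma card_matchingPerms_succ_le (hd : RegularDeg G d) (hd0 : 0 < d)
    (hN : SpanningRegular G N r) (hη : η ≤ 1 / 4)
    (hW : ∀ σ x y, |walkCount G σ (m + 2) x y - (d : ℝ) ^ (m + 2) / Fintype.card V|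
      ≤ η * ((d : ℝ) ^ (m + 2) / Fintype.card V))
    {K : ℕ} (hm : (m + 1 : ℝ) * (2 * K + 2 * r + 2 * m + 6) * Fintype.card V ≤ η * d ^ 2)
    (hrd : (r + 2 * K : ℝ) ≤ η * d) {j : ℕ} (hj : j + 1 ≤ K) :
    2 * (j + 1) * d * ((1 - η) * (1 - 2 * η)) * ((matchingPerms G N (j + 1)).card : ℝ)
      ≤ r * Fintype.card V * (1 + η) * ((matchingPerms G N j).card : ℝ) := by
  have hr := hN.card_edgeNbr
  set D := (d : ℝ) ^ (m + 2) / Fintype.card V with hD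
  have hD0 : 0 < D := by positivity
  have hjK : (j + 1 : ℝ) ≤ K := by exact_mod_cast hj
  have h : ∑ σ ∈ matchingPerms G N (j + 1),
      ((goodWalks G σ N m (goodFixPairs G N σ)).card : ℝ) ≤
      ∑ σ ∈ matchingPerms G N j, (((closedWalks G σ (m + 1)).filter fun a =>
        s(σ (a (Fin.last _)), a 0) ∈ N).card : ℝ) := by
    exact_mod_cast sum_goodFix_le m j
  have hlow : ∀ σ ∈ matchingPerms G N (j + 1),
      2 * (j + 1) * d * (1 - η) * ((1 - 2 * η) * D) ≤
        ((goodWalks G σ N m (goodFixPairs G N σ)).card : ℝ) := by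
    intro σ hσ
    have hc := (mem_matchingPerms.1 hσ).2.2
    refine le_trans ?_ (le_card_goodWalks _ (le_card_avoidWalks_of_walkCount hd hd0 hr (hW σ) hm
      (hc.trans_le (by omega))))
    refine mul_le_mul_of_nonneg_right ?_ (mul_nonneg (by linarith) hD0.le)
    have hg := le_card_goodFixPairs (σ := σ) hd hr
    rw [hc] at hg
    have hg' : ((2 * (j + 1) : ℕ) : ℝ) * d ≤ (goodFixPairs G N σ).card
        + ((2 * (j + 1) : ℕ) : ℝ) * ((2 * (j + 1) : ℕ) + r) := by exact_mod_cast hg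
    push_cast at hg'
    nlinarith [mul_le_mul_of_nonneg_left (by linarith : 2 * ((j : ℝ) + 1) + r ≤ η * d)
      (by positivity : (0 : ℝ) ≤ 2 * ((j : ℝ) + 1))]
  have hup : ∀ σ ∈ matchingPerms G N j, (((closedWalks G σ (m + 1)).filter fun a =>
        s(σ (a (Fin.last _)), a 0) ∈ N).card : ℝ) ≤ Fintype.card V * r * ((1 + η) * D) := by
    intro σ _
    have := card_closedWalks_filter_le (G := G) (σ := σ) (m := m + 1) (U := (1 + η) * D)
      (fun x y => by linarith [(abs_le.1 (hW σ x y)).2]) (stepPairs N σ)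
      (fun a => s(σ (a (Fin.last _)), a 0) ∈ N) (fun a _ h => by simpa [stepPairs] using h)
    rw [card_stepPairs hr] at this
    exact_mod_cast this
  have h' := (card_nsmul_le_sum _ _ _ hlow).trans (h.trans (sum_le_card_nsmul _ _ _ hup))
  simp only [nsmul_eq_mul] at h'
  refine le_of_mul_le_mul_right ?_ hD0
  linarith

lemma card_matchingPerms_le_succ (hd : RegularDeg G d) (hd0 : 0 < d)
    (hN : SpanningRegular G N r) (hη : 0 ≤ η) (hη' : η ≤ 1 / 4)
    (hW : ∀ σ x y, |walkCount G σ (m + 2) x y - (d : ℝ) ^ (m + 2) / Fintype.card V|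
      ≤ η * ((d : ℝ) ^ (m + 2) / Fintype.card V))
    {K : ℕ} (hm : (m + 1 : ℝ) * (2 * K + 2 * r + 2 * m + 6) * Fintype.card V ≤ η * d ^ 2)
    (hK : (4 * K : ℝ) ≤ η * Fintype.card V) {j : ℕ} (hj : j + 1 ≤ K) :
    r * Fintype.card V * ((1 - η) * (1 - 2 * η)) * ((matchingPerms G N j).card : ℝ)
      ≤ 2 * (j + 1) * d * (1 + η) * ((matchingPerms G N (j + 1)).card : ℝ) := by
  have hr := hN.card_edgeNbr
  set D := (d : ℝ) ^ (m + 2) / Fintype.card V with hD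
  have hD0 : 0 < D := by positivity
  have hjK : (j + 1 : ℝ) ≤ K := by exact_mod_cast hj
  have h : ∑ σ ∈ matchingPerms G N j,
      ((goodWalks G σ N m (goodStepPairs N σ)).card : ℝ) ≤
      ∑ σ ∈ matchingPerms G N (j + 1), (((closedWalks G σ (m + 1)).filter fun a =>
        s(a 0, σ (a 0)) ∈ N).card : ℝ) := by
    exact_mod_cast sum_goodStep_le hN.1 m j
  have hlow : ∀ σ ∈ matchingPerms G N j,
      r * Fintype.card V * (1 - η) * ((1 - 2 * η) * D) ≤
        ((goodWalks G σ N m (goodStepPairs N σ)).card : ℝ) := by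
    intro σ hσ
    have hc := (mem_matchingPerms.1 hσ).2.2
    refine le_trans ?_ (le_card_goodWalks _ (le_card_avoidWalks_of_walkCount hd hd0 hr (hW σ) hm
      (hc.trans_le (by omega))))
    refine mul_le_mul_of_nonneg_right ?_ (mul_nonneg (by linarith) hD0.le)
    have hg := le_card_goodStepPairs (σ := σ) hr
    rw [hc] at hg
    have hg' : (Fintype.card V : ℝ) * r ≤ (goodStepPairs N σ).card
        + 2 * (((2 * j : ℕ) : ℝ) * r) := by exact_mod_cast hg
    push_cast at hg'
    nlinarith [mul_le_mul_of_nonneg_left (by linarith : 4 * (j : ℝ) ≤ η * Fintype.card V)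
      (by positivity : (0 : ℝ) ≤ r)]
  have hup : ∀ σ ∈ matchingPerms G N (j + 1), (((closedWalks G σ (m + 1)).filter fun a =>
        s(a 0, σ (a 0)) ∈ N).card : ℝ) ≤ 2 * (j + 1) * d * ((1 + η) * D) := by
    intro σ hσ
    have hc := (mem_matchingPerms.1 hσ).2.2
    refine (card_closedWalks_filter_le (G := G) (σ := σ) (m := m + 1) (U := (1 + η) * D)
      (fun x y => by linarith [(abs_le.1 (hW σ x y)).2]) (fixPairs G N σ)
      (fun a => s(a 0, σ (a 0)) ∈ N) (fun a ha h => ?_)).trans ?_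
    · classical
      have := mem_closedWalks.1 ha (Fin.last _)
      rw [finRotate_last] at this
      rw [fixPairs, mem_filter]
      exact ⟨mem_univ _, by simpa [edgeFix] using h, this⟩
    · refine mul_le_mul_of_nonneg_right ?_ (by positivity)
      have := card_fixPairs_le (N := N) (σ := σ) hd
      rw [hc] at this
      exact_mod_cast this
  have h' := (card_nsmul_le_sum _ _ _ hlow).trans (h.trans (sum_le_card_nsmul _ _ _ hup))
  simp only [nsmul_eq_mul] at h'
  refine le_of_mul_le_mul_right ?_ hD0
  linarith

lemma pmCountInter_ratio (hd : RegularDeg G d) (hd0 : 0 < d) (hr0 : 0 < r)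
    (hN : SpanningRegular G N r) (heven : Even (Fintype.card V)) (hη : 0 ≤ η) (hη' : η ≤ 1 / 16)
    (hW : ∀ σ x y, |walkCount G σ (m + 2) x y - (d : ℝ) ^ (m + 2) / Fintype.card V|
      ≤ η * ((d : ℝ) ^ (m + 2) / Fintype.card V))
    {k : ℕ} (hk : 1 ≤ k)
    (hm : (m + 1 : ℝ) * (2 * k + 2 * r + 2 * m + 6) * Fintype.card V ≤ η * d ^ 2)
    (hrd : (r + 2 * k : ℝ) ≤ η * d) (hkn : (4 * k : ℝ) ≤ η * Fintype.card V) :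
    pmCountInter G N (k - 1) ≠ 0 ∧
      (1 - 16 * η) * (((r : ℝ) * Fintype.card V / 2) / (k * d)) ≤
        (pmCountInter G N k : ℝ) / (pmCountInter G N (k - 1) : ℝ) ∧
      (pmCountInter G N k : ℝ) / (pmCountInter G N (k - 1) : ℝ) ≤
        (1 + 16 * η) * (((r : ℝ) * Fintype.card V / 2) / (k * d)) := by
  have hdR : (0 : ℝ) < d := by exact_mod_cast hd0
  have hkR : (1 : ℝ) ≤ k := by exact_mod_cast hk
  have hrR : (0 : ℝ) < r := by exact_mod_cast hr0
  have hn : (0 : ℝ) < Fintype.card V := by exact_mod_cast Fintype.card_pos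
  have hrd' : r + 1 < d := by
    have : (r + 1 : ℝ) < d := by nlinarith
    exact_mod_cast this
  have hpos : ∀ j, j + 1 ≤ k → 0 < (matchingPerms G N j).card := by
    intro j
    induction j with
    | zero =>
      intro _
      refine card_pos.2 (exists_mem_matchingPerms_zero (m := m) hd hN.card_edgeNbr hrd' heven
        fun σ x y => ?_)
      have := le_card_avoidWalks_of_walkCount hd hd0 hN.card_edgeNbr (hW σ) hm
        (F := ∅) (by simp) x y
      rw [empty_union] at this
      rw [← card_pos, ← Nat.cast_pos (α := ℝ)]
      refine lt_of_lt_of_le (mul_pos (by linarith) (by positivity)) this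
    | succ j ih =>
      intro hj
      have h := card_matchingPerms_le_succ hd hd0 hN hη (by linarith) hW hm hkn
        (by omega : j + 1 ≤ k)
      have hP : (0 : ℝ) < (matchingPerms G N j).card := by exact_mod_cast ih (by omega)
      have h0 : (0 : ℝ) < (1 - η) * (1 - 2 * η) := mul_pos (by linarith) (by linarith)
      have h1 := lt_of_lt_of_le (by positivity) h
      exact_mod_cast pos_of_mul_pos_right h1 (by positivity)
  obtain ⟨j, rfl⟩ : ∃ j, k = j + 1 := ⟨k - 1, by omega⟩
  have hP : (0 : ℝ) < (matchingPerms G N j).card := by exact_mod_cast hpos j le_rfl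
  have h1 := card_matchingPerms_succ_le hd hd0 hN (by linarith) hW hm hrd le_rfl
  have h2 := card_matchingPerms_le_succ hd hd0 hN hη (by linarith) hW hm hkn le_rfl
  rw [Nat.add_sub_cancel]
  simp only [pmCountInter_eq_card]
  set P := ((matchingPerms G N j).card : ℝ)
  set P' := ((matchingPerms G N (j + 1)).card : ℝ)
  set n := (Fintype.card V : ℝ)
  have hc : 1 - 3 * η ≤ (1 - η) * (1 - 2 * η) := by nlinarith
  have hP' : 0 ≤ P' := by positivity
  push_cast
  refine ⟨(hpos j le_rfl).ne', ?_, ?_⟩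
  · rw [le_div_iff₀ hP, ← mul_div_assoc, div_mul_eq_mul_div, div_le_iff₀ (by positivity)]
    have hq : (1 - 16 * η) * (1 + η) ≤ (1 - η) * (1 - 2 * η) := by nlinarith
    refine le_of_mul_le_mul_right ?_ (by linarith : 0 < 1 + η)
    have := mul_le_mul_of_nonneg_right hq (by positivity : 0 ≤ r * n * P)
    linarith
  · rw [div_le_iff₀ hP, ← mul_div_assoc, div_mul_eq_mul_div, le_div_iff₀ (by positivity)]
    have hq : 1 + η ≤ (1 + 16 * η) * ((1 - η) * (1 - 2 * η)) := by nlinarith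
    refine le_of_mul_le_mul_right ?_
      (mul_pos (by linarith) (by linarith) : 0 < (1 - η) * (1 - 2 * η))
    have := mul_le_mul_of_nonneg_right hq (by positivity : 0 ≤ r * n * P)
    linarith

end Ratio

end Matchings

lemma eventually_parameters {δ ε : ℝ} (hδ : 0 < δ) (hε : 0 < ε) (hε' : ε ≤ 1) (s : ℕ) :
    ∀ᶠ n : ℕ in Filter.atTop, ∃ q : ℕ, 1 ≤ q ∧
      (1 - ε) ^ q ≤ δ * ((n : ℝ) ^ (-(1 / 7) : ℝ) / 16) ∧
      ∀ r k : ℕ, (r : ℝ) ≤ (n : ℝ) ^ ((1 : ℝ) / 3) → (k : ℝ) ≤ (n : ℝ) ^ ((1 : ℝ) / 3) →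
        (s * q : ℝ) * (2 * k + 2 * r + 2 * (s * q) + 4) * n
          ≤ (n : ℝ) ^ (-(1 / 7) : ℝ) / 16 * (δ * n) ^ 2 ∧
        (r + 2 * k : ℝ) ≤ (n : ℝ) ^ (-(1 / 7) : ℝ) / 16 * (δ * n) ∧
        (4 * k : ℝ) ≤ (n : ℝ) ^ (-(1 / 7) : ℝ) / 16 * n := by
  have hcast := tendsto_natCast_atTop_atTop (R := ℝ)
  have h1 : ∀ᶠ n : ℕ in Filter.atTop,
      ((n : ℝ) ^ ((1 : ℝ) / 10)) ^ ((10 : ℝ) / 7) * Real.exp (-ε * (n : ℝ) ^ ((1 : ℝ) / 10))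
        < δ / 16 :=
    (((tendsto_rpow_mul_exp_neg_mul_atTop_nhds_zero ((10 : ℝ) / 7) ε hε).comp
      (tendsto_rpow_atTop (by norm_num : (0 : ℝ) < 1 / 10))).comp hcast).eventually_lt_const
        (by positivity)
  have h2 := ((tendsto_rpow_atTop (by norm_num : (0 : ℝ) < 5 / 14)).comp hcast).eventually_ge_atTop
    (32 * s * (8 + 4 * s) / δ ^ 2 + 48 / δ + 64)
  filter_upwards [h1, h2, Filter.eventually_ge_atTop 1] with n h1 h2 hn
  have hn1 : (1 : ℝ) ≤ n := by exact_mod_cast hn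
  have hn0 : (0 : ℝ) < n := by linarith
  set x := (n : ℝ) ^ ((1 : ℝ) / 10) with hx
  have hx1 : 1 ≤ x := Real.one_le_rpow hn1 (by norm_num)
  have hq := Nat.le_ceil x
  have hq' : (⌈x⌉₊ : ℝ) ≤ 2 * x := by linarith [Nat.ceil_lt_add_one (by linarith : 0 ≤ x)]
  set q := ⌈x⌉₊
  set z := (n : ℝ) ^ (-(1 / 7) : ℝ) with hz
  set w := (n : ℝ) ^ ((1 : ℝ) / 3) with hw
  set u := (n : ℝ) ^ ((1 : ℝ) / 2) with hu
  have hz0 : 0 < z := Real.rpow_pos_of_pos hn0 _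
  have hw1 : 1 ≤ w := Real.one_le_rpow hn1 (by norm_num)
  have hxw : x ≤ w := Real.rpow_le_rpow_of_exponent_le hn1 (by norm_num)
  have hwu : w ≤ u := Real.rpow_le_rpow_of_exponent_le hn1 (by norm_num)
  have hxwu : x * w ≤ u := by
    rw [hx, hw, ← Real.rpow_add hn0]
    exact Real.rpow_le_rpow_of_exponent_le hn1 (by norm_num)
  have hzn : (n : ℝ) ^ ((5 : ℝ) / 14) * u = z * n := by
    rw [hu, hz, ← Real.rpow_add hn0]
    nth_rewrite 3 [← Real.rpow_one (n : ℝ)]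
    rw [← Real.rpow_add hn0]
    norm_num
  have hu0 : 0 < u := by linarith
  have hC : (32 * s * (8 + 4 * s) / δ ^ 2 + 48 / δ + 64) * u ≤ z * n := by
    rw [← hzn]
    exact mul_le_mul_of_nonneg_right h2 hu0.le
  have hA : 0 ≤ 32 * s * (8 + 4 * s) / δ ^ 2 * u := by positivity
  have hB : 0 ≤ 48 / δ * u := by positivity
  have hC1 : 32 * s * (8 + 4 * s) / δ ^ 2 * u ≤ z * n := by linarith
  have hC2 : 48 / δ * u ≤ z * n := by linarith
  have hC3 : 64 * u ≤ z * n := by linarith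
  rw [div_mul_eq_mul_div, div_le_iff₀ (by positivity)] at hC1 hC2
  refine ⟨q, Nat.one_le_ceil_iff.2 (by linarith), ?_, fun r k hr hk => ⟨?_, ?_, ?_⟩⟩
  · have hxz : x ^ ((10 : ℝ) / 7) * z = 1 := by
      rw [hx, hz, ← Real.rpow_mul hn0.le, ← Real.rpow_add hn0]
      norm_num
    have he : (1 - ε) ^ q ≤ Real.exp (-ε * x) := by
      calc (1 - ε) ^ q ≤ Real.exp (-ε) ^ q := by
            refine pow_le_pow_left₀ (by linarith) ?_ _
            linarith [Real.add_one_le_exp (-ε)]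
        _ = Real.exp (-ε * q) := by rw [← Real.exp_nat_mul, mul_comm]
        _ ≤ Real.exp (-ε * x) := Real.exp_le_exp.2 (by nlinarith)
    calc (1 - ε) ^ q ≤ Real.exp (-ε * x) := he
      _ = x ^ ((10 : ℝ) / 7) * Real.exp (-ε * x) * z := by
          rw [mul_right_comm, hxz, one_mul]
      _ ≤ δ / 16 * z := mul_le_mul_of_nonneg_right h1.le hz0.le
      _ = δ * (z / 16) := by ring
  · have hs0 : (0 : ℝ) ≤ s := by positivity
    have hsq : (s * q : ℝ) ≤ 2 * s * x := by nlinarith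
    have hsq' : (2 * k + 2 * r + 2 * (s * q) + 4 : ℝ) ≤ (8 + 4 * s) * w := by nlinarith
    calc (s * q : ℝ) * (2 * k + 2 * r + 2 * (s * q) + 4) * n
        ≤ (2 * s * x) * ((8 + 4 * s) * w) * n := by gcongr
      _ = 2 * s * (8 + 4 * s) * (x * w) * n := by ring
      _ ≤ 2 * s * (8 + 4 * s) * u * n := by gcongr
      _ ≤ z * n * δ ^ 2 / 16 * n := by gcongr; linarith
      _ = z / 16 * (δ * n) ^ 2 := by ring
  · linarith
  · linarith

lemma abs_walkCount_sub_le_of_robustExpander {V : Type*} [Fintype V] [DecidableEq V] [Nonempty V]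
    {G : SimpleGraph V} {d : ℕ} {ν τ δ η : ℝ} (hδ0 : 0 < δ) (hδ1 : δ ≤ 1) (hν : 0 < ν)
    (hτδ : 2 * τ ≤ δ) (hντ : ν ≤ τ) (hd : RegularDeg G d) (hδ : (d : ℝ) = δ * Fintype.card V)
    (hG : RobustExpander G ν τ) {i q : ℕ} (hi : 1 ≤ i * ν)
    (hq : (1 - ν ^ (i + 1)) ^ q ≤ δ * η) (σ : Equiv.Perm V) (x y : V) :
    |walkCount G σ ((i + 1) * q + 1) x y - (d : ℝ) ^ ((i + 1) * q + 1) / Fintype.card V|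
      ≤ η * ((d : ℝ) ^ ((i + 1) * q + 1) / Fintype.card V) := by
  have hn : (0 : ℝ) < Fintype.card V := by exact_mod_cast Fintype.card_pos
  have hβ := fun x y => pow_le_walkCount (σ := σ) hν hτδ hντ hd hδ hG hi x y
  refine (abs_walkCount_sub_le hd hβ q x y).trans ?_
  have h0 : 0 ≤ (d : ℝ) ^ (i + 1) - (ν * Fintype.card V) ^ i * Fintype.card V := by
    simpa using (abs_nonneg _).trans (abs_walkCount_sub_le hd hβ 1 x y)
  have hβ' : ν ^ (i + 1) * (d : ℝ) ^ (i + 1) ≤ (ν * Fintype.card V) ^ i * Fintype.card V := by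
    have hν1 : ν ≤ 1 := by linarith
    calc ν ^ (i + 1) * (d : ℝ) ^ (i + 1) ≤ ν ^ i * (Fintype.card V : ℝ) ^ (i + 1) := by
          refine mul_le_mul (pow_le_pow_of_le_one hν.le hν1 (Nat.le_succ i)) ?_ (by positivity)
            (by positivity)
          exact pow_le_pow_left₀ (by positivity) (by rw [hδ]; nlinarith) _
      _ = _ := by ring
  calc ((d : ℝ) ^ (i + 1) - (ν * Fintype.card V) ^ i * Fintype.card V) ^ q
      ≤ ((1 - ν ^ (i + 1)) * (d : ℝ) ^ (i + 1)) ^ q := pow_le_pow_left₀ h0 (by linarith) _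
    _ = (1 - ν ^ (i + 1)) ^ q * (d : ℝ) ^ ((i + 1) * q) := by rw [mul_pow, ← pow_mul]
    _ ≤ δ * η * (d : ℝ) ^ ((i + 1) * q) := by gcongr
    _ = η * ((d : ℝ) ^ ((i + 1) * q + 1) / Fintype.card V) := by
        rw [pow_succ, hδ]
        field_simp

/-- ratio estimate, spanning regular case. -/
theorem ratio_estimate_regular :
    ∀ δ : ℝ, 0 < δ → δ ≤ 1 →
    ∃ τ₀ : ℝ, 0 < τ₀ ∧
    ∀ τ ν : ℝ, 0 < ν → ν ≤ τ → τ ≤ τ₀ →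
    ∃ n₀ : ℕ, ∀ n : ℕ, n₀ ≤ n → Even n →
    ∀ r : ℕ, 1 ≤ r → (r : ℝ) ≤ (n : ℝ) ^ ((1 : ℝ) / 3) →
    ∀ (V : Type) [Fintype V] [DecidableEq V], Fintype.card V = n →
    ∀ G : SimpleGraph V,
      (∀ v : V, (Nat.card {u : V | G.Adj v u} : ℝ) = δ * (n : ℝ)) →
      RobustExpander G ν τ →
    ∀ N : Finset (Sym2 V), SpanningRegular G N r →
    ∀ k : ℕ, 1 ≤ k → (k : ℝ) ≤ (n : ℝ) ^ ((1 : ℝ) / 3) →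
      pmCountInter G N (k - 1) ≠ 0 ∧
      (1 - (n : ℝ) ^ (-(1 / 7) : ℝ)) * (((r : ℝ) * (n : ℝ) / 2) / ((k : ℝ) * δ * (n : ℝ))) ≤
        (pmCountInter G N k : ℝ) / (pmCountInter G N (k - 1) : ℝ) ∧
      (pmCountInter G N k : ℝ) / (pmCountInter G N (k - 1) : ℝ) ≤
        (1 + (n : ℝ) ^ (-(1 / 7) : ℝ)) * (((r : ℝ) * (n : ℝ) / 2) / ((k : ℝ) * δ * (n : ℝ))) := by
  intro δ hδ0 hδ1
  refine ⟨δ / 2, by positivity, fun τ ν hν hντ hτ => ?_⟩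
  obtain ⟨i, hi⟩ := exists_nat_ge (1 / ν)
  rw [div_le_iff₀ hν] at hi
  have hν1 : ν ≤ 1 := by linarith
  obtain ⟨n₀, hn₀⟩ := Filter.eventually_atTop.1 ((eventually_parameters hδ0
    (pow_pos hν (i + 1)) (pow_le_one₀ hν.le hν1) (i + 1)).and (Filter.eventually_ge_atTop 1))
  refine ⟨n₀, fun n hn heven r hr hrn V _ _ hV G hdeg hG N hN k hk hkn => ?_⟩
  obtain ⟨⟨q, hq1, hq, hpar⟩, hn1⟩ := hn₀ n hn
  obtain ⟨hp1, hp2, hp3⟩ := hpar r k hrn hkn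
  subst hV
  have : Nonempty V := Fintype.card_pos_iff.1 hn1
  have hnR : (1 : ℝ) ≤ Fintype.card V := by exact_mod_cast hn1
  obtain ⟨d, hd⟩ : ∃ d : ℕ, (d : ℝ) = δ * Fintype.card V := ⟨_, hdeg (Classical.arbitrary V)⟩
  have hreg : RegularDeg G d := fun v => by exact_mod_cast (hdeg v).trans hd.symm
  have hd0 : 0 < d := by
    have : (0 : ℝ) < d := by rw [hd]; positivity
    exact_mod_cast this
  obtain ⟨m, hm⟩ : ∃ m, (i + 1) * q = m + 1 :=
    ⟨(i + 1) * q - 1, (Nat.sub_add_cancel (Nat.mul_pos (Nat.succ_pos i) hq1)).symm⟩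
  have hmR : ((i + 1 : ℕ) * q : ℝ) = m + 1 := by exact_mod_cast hm
  have hW := abs_walkCount_sub_le_of_robustExpander hδ0 hδ1 hν (by linarith) hντ hreg hd hG hi hq
  rw [hm] at hW
  rw [hmR, ← hd] at hp1
  rw [← hd] at hp2
  have hθ : (Fintype.card V : ℝ) ^ (-(1 / 7) : ℝ) ≤ 1 :=
    Real.rpow_le_one_of_one_le_of_nonpos hnR (by norm_num)
  have := pmCountInter_ratio hreg hd0 hr hN heven (by positivity) (by linarith) hW hk
    (le_trans (le_of_eq (by ring)) hp1) hp2 hp3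
  rwa [mul_div_cancel₀ _ (by norm_num : (16 : ℝ) ≠ 0), hd, ← mul_assoc] at this

end RPM
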